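/- Let w̃ ∈ W̃₁, ω ∈ X with ω−η ∈ C₀, μ ∈ X, and s ∈ W. Then the following are equivalent: (a) there exists ũ ∈ W̃⁺ such that ũ ↑ w̃_h w̃ and t_ω ∈ t_μ s ũ⁻¹ W; (b) t_ω W̃_{≤ w₀w̃} ⊆ t_μ s Adm(η). -/

import Mathlib

open scoped Classical Pointwise

namespace SerrePaper

variable (V : Type) [AddCommGroup V] [Module ℝ V]

/-- The combinatorial context of the paper: the character lattice `X` of a split maximal
torus, sitting inside the real vector space `V = X ⊗ ℝ`, together with a reduced
crystallographic root system `R` with positive roots `Rpos`, simple roots `Δ`,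
the coroot pairing `coroot α = ⟨·, α∨⟩`, the weight `η` pairing to `1` with every simple
coroot, and the longest element `w0` of the Weyl group. -/
structure Ctx where
  R : Finset V
  Rpos : Finset V
  Δ : Finset V
  coroot : V → V →ₗ[ℝ] ℝ
  eta : V
  w0 : V ≃ₗ[ℝ] V
  X : AddSubgroup V
  pos_subset : Rpos ⊆ R
  simple_subset : Δ ⊆ Rpos
  root_ne_zero : ∀ α ∈ R, α ≠ (0 : V)
  neg_mem : ∀ α ∈ R, -α ∈ R
  pos_or_neg : ∀ α ∈ R, α ∈ Rpos ∨ -α ∈ Rpos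
  pos_not_neg : ∀ α ∈ Rpos, -α ∉ Rpos
  coroot_self : ∀ α ∈ R, coroot α α = 2
  coroot_neg : ∀ α ∈ R, coroot (-α) = -coroot α
  crystallographic : ∀ α ∈ R, ∀ β ∈ R, ∃ n : ℤ, coroot α β = (n : ℝ)
  reduced : ∀ α ∈ R, ∀ c : ℝ, c • α ∈ R → c = 1 ∨ c = -1
  reflect_root : ∀ α ∈ R, ∀ β ∈ R, β - coroot α β • α ∈ R
  reflect_coroot : ∀ α ∈ R, ∀ β ∈ R, ∀ x : V,
    coroot (β - coroot α β • α) x = coroot β x - coroot β α * coroot α x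
  pos_sum_simple : ∀ α ∈ Rpos, ∃ c : V → ℕ, α = ∑ β ∈ Δ, (c β : ℝ) • β
  simple_indep : LinearIndependent ℝ (fun β : {x // x ∈ Δ} => (β : V))
  eta_pair : ∀ α ∈ Δ, coroot α eta = 1
  root_mem_X : ∀ α ∈ R, α ∈ X
  eta_mem_X : eta ∈ X
  coroot_int : ∀ α ∈ R, ∀ x ∈ X, ∃ n : ℤ, coroot α x = (n : ℝ)
  w0_mem : w0 ∈ Subgroup.closure {g : V ≃ₗ[ℝ] V | ∃ α ∈ R, ∀ x, g x = x - coroot α x • α}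
  w0_neg : ∀ α ∈ Rpos, -(w0 α) ∈ Rpos

namespace Ctx

variable {V}
variable (S : Ctx V)

/-- The (finite) Weyl group, generated by the reflections `s_α`, `α ∈ R`. -/
def Weyl : Subgroup (V ≃ₗ[ℝ] V) :=
  Subgroup.closure {g : V ≃ₗ[ℝ] V | ∃ α ∈ S.R, ∀ x, g x = x - S.coroot α x • α}

/-- The translation `t_ν` as an affine automorphism of `V`. -/
def trans (_S : Ctx V) (ν : V) : V ≃ᵃ[ℝ] V := AffineEquiv.constVAdd ℝ V ν

/-- A linear automorphism viewed as an affine automorphism. -/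
def ofW (_S : Ctx V) (w : V ≃ₗ[ℝ] V) : V ≃ᵃ[ℝ] V := w.toAffineEquiv

/-- The extended affine Weyl group `W̃ = X ⋊ W`, realized as the set of affine
transformations of the form `t_ν ∘ w` with `ν ∈ X` and `w ∈ W`. -/
def extAff : Set (V ≃ᵃ[ℝ] V) :=
  {g | ∃ ν ∈ S.X, ∃ w ∈ S.Weyl, g = S.trans ν * S.ofW w}

/-- The base alcove `A₀`. -/
def A0 : Set V := {x | ∀ α ∈ S.Rpos, 0 < S.coroot α x ∧ S.coroot α x < 1}

/-- The affine hyperplane `⟨·,α∨⟩ = n` separates the base alcove `A₀` from its image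
`g(A₀)`. -/
def Separates (α : V) (n : ℤ) (g : V ≃ᵃ[ℝ] V) : Prop :=
  ((∀ x ∈ S.A0, S.coroot α x < (n : ℝ)) ∧ (∀ x ∈ S.A0, (n : ℝ) < S.coroot α (g x))) ∨
  ((∀ x ∈ S.A0, (n : ℝ) < S.coroot α x) ∧ (∀ x ∈ S.A0, S.coroot α (g x) < (n : ℝ)))

/-- The length `ℓ(g)` of an element of the extended affine Weyl group: the number of
affine root hyperplanes separating `A₀` from `g(A₀)`. -/
noncomputable def len (g : V ≃ᵃ[ℝ] V) : ℕ :=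
  Set.ncard {q : V × ℤ | q.1 ∈ S.Rpos ∧ S.Separates q.1 q.2 g}

/-- The set of affine reflections `s_{α,n} : x ↦ x - (⟨x,α∨⟩ - n)α`. -/
def affRefl : Set (V ≃ᵃ[ℝ] V) :=
  {g | ∃ α ∈ S.R, ∃ n : ℤ, ∀ x, g x = x - (S.coroot α x - (n : ℝ)) • α}

/-- The Bruhat order on the extended affine Weyl group, generated by
`u < r·u` for affine reflections `r` with `ℓ(u) < ℓ(r·u)` (this fixes the
`Ω`-component, so it is the componentwise extension of the Bruhat order on `W_a`). -/
def bruhatLE : (V ≃ᵃ[ℝ] V) → (V ≃ᵃ[ℝ] V) → Prop :=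
  Relation.ReflTransGen fun u w => (∃ r ∈ S.affRefl, w = r * u) ∧ S.len u < S.len w

/-- Jantzen's `↑`-order, transported to the (extended) affine Weyl group via
`w̃ ↦ w̃(A₀)`: generated by `u ↑ s_{α,n}·u` whenever `u(A₀)` lies below the hyperplane
`⟨·,α∨⟩ = n`.  (Under the affine rescaling `λ ↦ (λ+η)/p` this is equivalent to the usual
`↑`-order on `p`-alcoves, transported via the `p`-dot action `w̃ ↦ w̃ · C₀`.) -/
def upLE : (V ≃ᵃ[ℝ] V) → (V ≃ᵃ[ℝ] V) → Prop :=
  Relation.ReflTransGen fun u w =>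
    ∃ α ∈ S.Rpos, ∃ n : ℤ,
      (∀ x : V, w x = u x - (S.coroot α (u x) - (n : ℝ)) • α) ∧
      ∀ x ∈ S.A0, S.coroot α (u x) < (n : ℝ)

/-- `W̃⁺`: the elements of `W̃` taking the base alcove to a dominant alcove. -/
def Wplus : Set (V ≃ᵃ[ℝ] V) :=
  {g | g ∈ S.extAff ∧ ∀ x ∈ S.A0, ∀ α ∈ S.Δ, 0 < S.coroot α (g x)}

/-- `W̃₁`: the elements of `W̃` taking the base alcove to a restricted alcove. -/
def Wone : Set (V ≃ᵃ[ℝ] V) :=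
  {g | g ∈ S.extAff ∧ ∀ x ∈ S.A0, ∀ α ∈ S.Δ,
    0 < S.coroot α (g x) ∧ S.coroot α (g x) < 1}

/-- `w̃_h = w₀ t_{-η}`. -/
noncomputable def wh : V ≃ᵃ[ℝ] V := S.ofW S.w0 * S.trans (-S.eta)

/-- The lowest `p`-alcove `C₀`. -/
def C0 (p : ℕ) : Set V :=
  {x | ∀ α ∈ S.Rpos, 0 < S.coroot α (x + S.eta) ∧ S.coroot α (x + S.eta) < (p : ℝ)}

/-- The root lattice `ℤR`. -/
def rootLattice : AddSubgroup V := AddSubgroup.closure (S.R : Set V)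

/-- `Ω`: the stabilizer of the base alcove in `W̃`. -/
def Omega : Set (V ≃ᵃ[ℝ] V) := {g | g ∈ S.extAff ∧ g '' S.A0 = S.A0}

/-- The `λ`-admissible set `Adm(λ) = ⋃_{w ∈ W} W̃_{≤ t_{w(λ)}}`. -/
def Adm (lam : V) : Set (V ≃ᵃ[ℝ] V) :=
  {g | ∃ w ∈ S.Weyl, S.bruhatLE g (S.trans (w lam))}

/-- `α∨` is a highest coroot, i.e. the highest root of an irreducible component of the
dual root system `R∨`: equivalently, `α∨` is a dominant coroot and no simple coroot can
be added to `α∨` to yield a coroot. -/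
def IsHighestCoroot (α : V) : Prop :=
  α ∈ S.R ∧ (∀ β ∈ S.Δ, 0 ≤ S.coroot α β) ∧
    ∀ β ∈ S.Δ, ∀ γ ∈ S.R, S.coroot γ ≠ S.coroot α + S.coroot β

end Ctx

namespace Ctx

variable {V}
variable (S : Ctx V)

/-! ### Affine reflections and the Weyl group -/

/-- The linear reflection `s_α`, for a root `α`. -/
noncomputable def linRefl (α : V) : V ≃ₗ[ℝ] V :=
  if h : S.coroot α α = 2 then Module.reflection h else 1

/-- The affine reflection `s_{α,n}`, for a root `α`. -/
noncomputable def refl (α : V) (n : ℤ) : V ≃ᵃ[ℝ] V :=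
  S.trans ((n : ℝ) • α) * S.ofW (S.linRefl α)

lemma trans_apply (ν x : V) : S.trans ν x = ν + x := rfl

lemma ofW_apply (w : V ≃ₗ[ℝ] V) (x : V) : S.ofW w x = w x := rfl

lemma affine_mul_apply (g h : V ≃ᵃ[ℝ] V) (x : V) : (g * h) x = g (h x) := rfl

lemma linear_mul_apply (g h : V ≃ₗ[ℝ] V) (x : V) : (g * h) x = g (h x) := rfl

lemma linear_apply_inv (g : V ≃ₗ[ℝ] V) (x : V) : g (g⁻¹ x) = x := g.apply_symm_apply x

lemma linear_inv_apply (g : V ≃ₗ[ℝ] V) (x : V) : g⁻¹ (g x) = x := g.symm_apply_apply x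

lemma affine_inv_apply (g : V ≃ᵃ[ℝ] V) (x : V) : g⁻¹ (g x) = x := g.symm_apply_apply x

lemma ofW_mul (v w : V ≃ₗ[ℝ] V) : S.ofW (v * w) = S.ofW v * S.ofW w := rfl

lemma ofW_one : S.ofW 1 = 1 := rfl

lemma ofW_inv (w : V ≃ₗ[ℝ] V) : S.ofW w⁻¹ = (S.ofW w)⁻¹ := rfl

lemma trans_add (ν κ : V) : S.trans (ν + κ) = S.trans ν * S.trans κ := by
  ext x; simp only [affine_mul_apply, trans_apply, add_assoc]

lemma trans_zero : S.trans 0 = 1 := by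
  ext x; exact zero_add x

lemma trans_neg (ν : V) : S.trans (-ν) = (S.trans ν)⁻¹ := by
  rw [eq_inv_iff_mul_eq_one, ← trans_add, neg_add_cancel, trans_zero]

lemma ofW_mul_trans (w : V ≃ₗ[ℝ] V) (ν : V) :
    S.ofW w * S.trans ν = S.trans (w ν) * S.ofW w := by
  ext x; simp only [affine_mul_apply, trans_apply, ofW_apply, map_add]

variable {S}

lemma linRefl_apply {α : V} (hα : α ∈ S.R) (x : V) :
    S.linRefl α x = x - S.coroot α x • α := by
  rw [linRefl, dif_pos (S.coroot_self α hα), Module.reflection_apply]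

lemma refl_apply {α : V} (hα : α ∈ S.R) (n : ℤ) (x : V) :
    S.refl α n x = x - (S.coroot α x - n) • α := by
  rw [refl, affine_mul_apply, trans_apply, ofW_apply, linRefl_apply hα]
  module

lemma linRefl_mem {α : V} (hα : α ∈ S.R) : S.linRefl α ∈ S.Weyl :=
  Subgroup.subset_closure ⟨α, hα, linRefl_apply hα⟩

lemma linRefl_mul_self {α : V} (hα : α ∈ S.R) : S.linRefl α * S.linRefl α = 1 := by
  ext x
  rw [linear_mul_apply, linRefl_apply hα, linRefl_apply hα, map_sub, map_smul,
    S.coroot_self α hα, smul_eq_mul, LinearEquiv.coe_one, id]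
  module

lemma refl_mul_self {α : V} (hα : α ∈ S.R) (n : ℤ) : S.refl α n * S.refl α n = 1 := by
  ext x
  rw [affine_mul_apply, refl_apply hα, refl_apply hα, map_sub, map_smul,
    S.coroot_self α hα, smul_eq_mul, AffineEquiv.coe_one, id]
  module

lemma refl_refl {α : V} (hα : α ∈ S.R) (n : ℤ) (x : V) : S.refl α n (S.refl α n x) = x := by
  rw [← affine_mul_apply, refl_mul_self hα]; rfl

lemma refl_mul_refl {α : V} (hα : α ∈ S.R) (n : ℤ) (g : V ≃ᵃ[ℝ] V) :
    S.refl α n * (S.refl α n * g) = g := by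
  rw [← mul_assoc, refl_mul_self hα, one_mul]

lemma refl_neg {α : V} (hα : α ∈ S.R) (n : ℤ) : S.refl (-α) (-n) = S.refl α n := by
  ext x
  rw [refl_apply hα, refl_apply (S.neg_mem α hα), S.coroot_neg α hα, LinearMap.neg_apply]
  push_cast
  module

lemma coroot_refl {α : V} (hα : α ∈ S.R) (n : ℤ) (γ x : V) :
    S.coroot γ (S.refl α n x) = S.coroot γ x - (S.coroot α x - n) * S.coroot γ α := by
  rw [refl_apply hα, map_sub, map_smul, smul_eq_mul]

lemma coroot_refl_self {α : V} (hα : α ∈ S.R) (n : ℤ) (x : V) :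
    S.coroot α (S.refl α n x) = 2 * n - S.coroot α x := by
  rw [coroot_refl hα, S.coroot_self α hα]; ring

lemma pos_mem {α : V} (hα : α ∈ S.Rpos) : α ∈ S.R := S.pos_subset hα

lemma simple_pos {α : V} (hα : α ∈ S.Δ) : α ∈ S.Rpos := S.simple_subset hα

lemma simple_mem {α : V} (hα : α ∈ S.Δ) : α ∈ S.R := pos_mem (simple_pos hα)

lemma coroot_neg_apply {α : V} (hα : α ∈ S.R) (x : V) : S.coroot (-α) x = -S.coroot α x := by
  rw [S.coroot_neg α hα, LinearMap.neg_apply]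

lemma weyl_induction {P : (V ≃ₗ[ℝ] V) → Prop} (one : P 1)
    (mul : ∀ α ∈ S.R, ∀ w ∈ S.Weyl, P w → P (S.linRefl α * w)) {w : V ≃ₗ[ℝ] V}
    (hw : w ∈ S.Weyl) : P w := by
  have key : ∀ g : V ≃ₗ[ℝ] V, (∃ α ∈ S.R, ∀ x, g x = x - S.coroot α x • α) →
      ∃ α ∈ S.R, g = S.linRefl α ∧ g⁻¹ = S.linRefl α := by
    rintro g ⟨α, hα, hg⟩
    have : g = S.linRefl α := by ext x; rw [hg, linRefl_apply hα]
    refine ⟨α, hα, this, ?_⟩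
    rw [this, inv_eq_iff_mul_eq_one, linRefl_mul_self hα]
  refine Subgroup.closure_induction_left (p := fun w _ => P w) one ?_ ?_ hw
  · intro g hg y hy ih
    obtain ⟨α, hα, h, -⟩ := key g hg
    exact h ▸ mul α hα y hy ih
  · intro g hg y hy ih
    obtain ⟨α, hα, -, h⟩ := key g hg
    exact h ▸ mul α hα y hy ih

lemma weyl_root {w : V ≃ₗ[ℝ] V} (hw : w ∈ S.Weyl) :
    ∀ α ∈ S.R, w α ∈ S.R ∧ ∀ x, S.coroot (w α) (w x) = S.coroot α x := by
  refine weyl_induction (P := fun w => ∀ α ∈ S.R, w α ∈ S.R ∧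
    ∀ x, S.coroot (w α) (w x) = S.coroot α x) (fun α hα => ⟨hα, fun x => rfl⟩) ?_ hw
  intro β hβ w _ ih α hα
  obtain ⟨h1, h2⟩ := ih α hα
  rw [linear_mul_apply, linRefl_apply hβ]
  refine ⟨S.reflect_root β hβ _ h1, fun x => ?_⟩
  rw [S.reflect_coroot β hβ _ h1, linear_mul_apply, linRefl_apply hβ, ← h2 x]
  simp only [map_sub, map_smul, smul_eq_mul, S.coroot_self β hβ]
  ring

lemma coroot_weyl {w : V ≃ₗ[ℝ] V} (hw : w ∈ S.Weyl) {α : V} (hα : α ∈ S.R) (x : V) :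
    S.coroot (w α) x = S.coroot α (w⁻¹ x) := by
  rw [← (weyl_root hw α hα).2, linear_apply_inv]

lemma weyl_X {w : V ≃ₗ[ℝ] V} (hw : w ∈ S.Weyl) : ∀ x ∈ S.X, w x ∈ S.X := by
  refine weyl_induction (P := fun w => ∀ x ∈ S.X, w x ∈ S.X) (fun x hx => hx) ?_ hw
  intro β hβ w _ ih x hx
  rw [linear_mul_apply, linRefl_apply hβ]
  obtain ⟨n, hn⟩ := S.coroot_int β hβ _ (ih x hx)
  rw [hn, Int.cast_smul_eq_zsmul]
  exact S.X.sub_mem (ih x hx) (S.X.zsmul_mem (S.root_mem_X β hβ) n)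

/-! ### The extended affine Weyl group -/

lemma trans_mem {ν : V} (hν : ν ∈ S.X) : S.trans ν ∈ S.extAff :=
  ⟨ν, hν, 1, S.Weyl.one_mem, rfl⟩

lemma ofW_mem {w : V ≃ₗ[ℝ] V} (hw : w ∈ S.Weyl) : S.ofW w ∈ S.extAff :=
  ⟨0, S.X.zero_mem, w, hw, by rw [trans_zero, one_mul]⟩

lemma extAff_mul {g h : V ≃ᵃ[ℝ] V} (hg : g ∈ S.extAff) (hh : h ∈ S.extAff) :
    g * h ∈ S.extAff := by
  obtain ⟨ν, hν, v, hv, rfl⟩ := hg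
  obtain ⟨κ, hκ, w, hw, rfl⟩ := hh
  refine ⟨ν + v κ, S.X.add_mem hν (weyl_X hv κ hκ), v * w, S.Weyl.mul_mem hv hw, ?_⟩
  rw [trans_add, ofW_mul, mul_assoc, ← mul_assoc (S.ofW v), ofW_mul_trans]
  simp only [mul_assoc]

lemma extAff_inv {g : V ≃ᵃ[ℝ] V} (hg : g ∈ S.extAff) : g⁻¹ ∈ S.extAff := by
  obtain ⟨ν, hν, v, hv, rfl⟩ := hg
  rw [mul_inv_rev, ← trans_neg, ← ofW_inv]
  exact extAff_mul (ofW_mem (S.Weyl.inv_mem hv)) (trans_mem (S.X.neg_mem hν))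

lemma intSmul_root_mem {α : V} (hα : α ∈ S.R) (n : ℤ) : (n : ℝ) • α ∈ S.X := by
  rw [Int.cast_smul_eq_zsmul]
  exact S.X.zsmul_mem (S.root_mem_X α hα) n

lemma refl_mem {α : V} (hα : α ∈ S.R) (n : ℤ) : S.refl α n ∈ S.extAff :=
  ⟨_, intSmul_root_mem hα n, _, linRefl_mem hα, rfl⟩

lemma trans_mul_refl {ν : V} {α : V} (hα : α ∈ S.R) {k : ℤ} (hk : S.coroot α ν = k) (n : ℤ) :
    S.trans ν * S.refl α n = S.refl α (n + k) * S.trans ν := by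
  ext x
  simp only [affine_mul_apply, trans_apply, refl_apply hα, map_add, hk]
  push_cast
  module

lemma ofW_mul_refl {w : V ≃ₗ[ℝ] V} (hw : w ∈ S.Weyl) {α : V} (hα : α ∈ S.R) (n : ℤ) :
    S.ofW w * S.refl α n = S.refl (w α) n * S.ofW w := by
  obtain ⟨h1, h2⟩ := weyl_root hw α hα
  ext x
  simp only [affine_mul_apply, ofW_apply, refl_apply hα, refl_apply h1, h2, map_sub, map_smul]

/-- An element of the extended affine Weyl group permutes the affine root hyperplanes,
together with their half-spaces. -/
lemma transport {g : V ≃ᵃ[ℝ] V} (hg : g ∈ S.extAff) {γ : V} (hγ : γ ∈ S.R) (m : ℤ) :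
    ∃ δ ∈ S.R, ∃ k : ℤ, (∀ x, S.coroot δ (g x) - k = S.coroot γ x - m) ∧
      g * S.refl γ m = S.refl δ k * g := by
  obtain ⟨ν, hν, w, hw, rfl⟩ := hg
  obtain ⟨h1, h2⟩ := weyl_root hw γ hγ
  obtain ⟨n, hn⟩ := S.coroot_int _ h1 ν hν
  refine ⟨w γ, h1, m + n, fun x => ?_, ?_⟩
  · rw [affine_mul_apply, trans_apply, ofW_apply, map_add, h2, hn]
    push_cast
    ring
  · rw [mul_assoc, ofW_mul_refl hw hγ, ← mul_assoc, trans_mul_refl h1 hn, mul_assoc]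

/-! ### An invariant form, and positivity of coroots -/

variable (S) in
/-- A Weyl-invariant positive semidefinite bilinear form. -/
noncomputable def form (x y : V) : ℝ := ∑ γ ∈ S.R, S.coroot γ x * S.coroot γ y

lemma form_linRefl {α : V} (hα : α ∈ S.R) (x y : V) :
    S.form (S.linRefl α x) (S.linRefl α y) = S.form x y := by
  have hinv : ∀ z, S.linRefl α (S.linRefl α z) = z := fun z => by
    rw [← linear_mul_apply, linRefl_mul_self hα]; rfl
  refine Finset.sum_nbij' (fun γ => S.linRefl α γ) (fun γ => S.linRefl α γ)
    (fun γ hγ => (weyl_root (linRefl_mem hα) γ hγ).1)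
    (fun γ hγ => (weyl_root (linRefl_mem hα) γ hγ).1) (fun γ _ => hinv γ)
    (fun γ _ => hinv γ) fun γ hγ => ?_
  rw [← (weyl_root (linRefl_mem hα) γ hγ).2, ← (weyl_root (linRefl_mem hα) γ hγ).2 (S.linRefl α y),
    hinv, hinv]

lemma form_sub_smul (x y z : V) (c : ℝ) :
    S.form x (y - c • z) = S.form x y - c * S.form x z := by
  simp only [form, Finset.mul_sum, ← Finset.sum_sub_distrib]
  refine Finset.sum_congr rfl fun γ _ => ?_
  rw [map_sub, map_smul, smul_eq_mul]
  ring

lemma form_comm (x y : V) : S.form x y = S.form y x :=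
  Finset.sum_congr rfl fun _ _ => mul_comm _ _

lemma form_neg_left (x y : V) : S.form (-x) y = -S.form x y := by
  simp only [form, ← Finset.sum_neg_distrib, map_neg, neg_mul]

lemma form_self_pos {α : V} (hα : α ∈ S.R) : 0 < S.form α α := by
  refine Finset.sum_pos' (fun γ _ => mul_self_nonneg _) ⟨α, hα, ?_⟩
  rw [S.coroot_self α hα]; norm_num

lemma coroot_mul_form {α : V} (hα : α ∈ S.R) (x : V) :
    S.coroot α x * S.form α α = 2 * S.form α x := by
  have h := form_linRefl hα α x
  rw [linRefl_apply hα α, linRefl_apply hα x, S.coroot_self α hα,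
    show α - (2 : ℝ) • α = -α by module, form_neg_left, form_sub_smul] at h
  linarith

lemma coroot_eq_zero_of_form_self {x : V} (hx : S.form x x = 0) {γ : V} (hγ : γ ∈ S.R) :
    S.coroot γ x = 0 := by
  have := (Finset.sum_eq_zero_iff_of_nonneg (fun γ _ => mul_self_nonneg _)).1 hx γ hγ
  exact mul_self_eq_zero.1 this

lemma coroot_pos {x : V} (hx : ∀ β ∈ S.Δ, 0 < S.coroot β x) {α : V} (hα : α ∈ S.Rpos) :
    0 < S.coroot α x := by
  obtain ⟨c, hc⟩ := S.pos_sum_simple α hα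
  have hB : S.form α x = ∑ β ∈ S.Δ, (c β : ℝ) * S.form β x := by
    simp only [form]
    simp_rw [Finset.mul_sum]
    rw [Finset.sum_comm]
    refine Finset.sum_congr rfl fun γ _ => ?_
    conv_lhs => rw [hc]
    rw [map_sum, Finset.sum_mul]
    refine Finset.sum_congr rfl fun β _ => ?_
    rw [map_smul, smul_eq_mul, mul_assoc]
  have hpos : ∀ β ∈ S.Δ, 0 < S.form β x := fun β hβ => by
    have := coroot_mul_form (simple_mem hβ) x
    have := mul_pos (hx β hβ) (form_self_pos (simple_mem hβ))
    linarith
  have hne : ∃ β ∈ S.Δ, c β ≠ 0 := by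
    by_contra! h
    refine S.root_ne_zero α (pos_mem hα) ?_
    rw [hc]
    exact Finset.sum_eq_zero fun β hβ => by rw [h β hβ]; simp
  have : 0 < S.form α x := by
    rw [hB]
    obtain ⟨β, hβ, h⟩ := hne
    exact Finset.sum_pos' (fun β hβ => mul_nonneg (Nat.cast_nonneg _) (hpos β hβ).le)
      ⟨β, hβ, mul_pos (Nat.cast_pos.2 (Nat.pos_of_ne_zero h)) (hpos β hβ)⟩
  have h2 := coroot_mul_form (pos_mem hα) x
  have h3 := form_self_pos (pos_mem hα)
  by_contra! h4
  nlinarith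

/-- Two roots whose difference, up to scaling, is killed by all coroots are proportional. -/
lemma eq_smul_of_coroot_eq_zero {α γ : V} (hα : α ∈ S.R) (hγ : γ ∈ S.R) (t : ℝ)
    (h : ∀ β ∈ S.R, S.coroot β (γ - t • α) = 0) : γ = t • α := by
  by_contra hne
  set d := γ - t • α with hd
  have hd0 : d ≠ 0 := sub_ne_zero.2 hne
  have hmem : ∀ k : ℕ, t • α + (2 * k + 1 : ℝ) • d ∈ S.R := by
    intro k
    induction k with
    | zero => convert hγ using 1; rw [hd]; push_cast; module
    | succ k ih =>
      have h1 := S.reflect_root α hα _ ih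
      have h2 := S.reflect_root γ hγ _ h1
      have e1 : S.coroot γ α * t = 2 := by
        have := h γ hγ
        rw [map_sub, map_smul, S.coroot_self γ hγ, smul_eq_mul] at this
        linarith
      simp only [map_sub, map_add, map_smul, h α hα, h γ hγ, S.coroot_self α hα,
        smul_eq_mul] at h2
      convert h2 using 1
      have : t * S.coroot γ α + (2 * (k : ℝ) + 1) * 0 -
          (t * 2 + (2 * (k : ℝ) + 1) * 0) * S.coroot γ α = -2 := by linear_combination -e1
      rw [this]
      have : γ = t • α + d := by rw [hd]; module
      rw [this]
      push_cast
      module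
  refine not_injective_infinite_finite (fun k : ℕ => (⟨_, hmem k⟩ : S.R)) fun i j hij => ?_
  have h1 : ((2 * i + 1 : ℝ) - (2 * j + 1)) • d = 0 := by
    rw [sub_smul, sub_eq_zero]
    exact add_left_cancel (Subtype.ext_iff.1 hij)
  have h2 := (smul_eq_zero.1 h1).resolve_right hd0
  have h3 : (i : ℝ) = j := by linarith
  exact_mod_cast h3

/-- Equality in Cauchy-Schwarz for roots. -/
lemma eq_of_form_ge {α γ : V} (hα : α ∈ S.R) (hγ : γ ∈ S.R) (hpos : 0 < S.coroot γ α)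
    (h : S.form α α * S.form γ γ ≤ S.form α γ ^ 2) : γ = α := by
  have ha := form_self_pos hα
  set t := S.form α γ / S.form α α with ht
  have ht' : t * S.form α α = S.form α γ := div_mul_cancel₀ _ ha.ne'
  have hnn : 0 ≤ S.form (γ - t • α) (γ - t • α) := Finset.sum_nonneg fun _ _ => mul_self_nonneg _
  have hexp : S.form (γ - t • α) (γ - t • α) =
      S.form γ γ - 2 * t * S.form α γ + t ^ 2 * S.form α α := by
    rw [form_sub_smul, form_comm _ γ, form_comm _ α, form_sub_smul, form_sub_smul,
      form_comm γ α]
    ring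
  have hz : S.form (γ - t • α) (γ - t • α) = 0 := by
    rw [← ht'] at h hexp
    nlinarith
  have hprop := eq_smul_of_coroot_eq_zero hα hγ t fun β hβ => coroot_eq_zero_of_form_self hz hβ
  have hγ' := hγ
  rw [hprop] at hγ'
  rcases S.reduced α hα t hγ' with h1 | h1
  · rw [hprop, h1, one_smul]
  · exfalso
    have h2 := S.coroot_self γ hγ
    have h3 : γ = -α := by rw [hprop, h1]; module
    have h4 : S.coroot γ γ = -S.coroot γ α := by
      conv_lhs => rw [show S.coroot γ γ = S.coroot γ (-α) by rw [← h3]]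
      rw [map_neg]
    linarith

/-! ### A base point -/

variable (S) in
/-- A point of the base alcove. -/
noncomputable def base : V := (1 + ∑ α ∈ S.Rpos, S.coroot α S.eta)⁻¹ • S.eta

lemma coroot_eta_pos {α : V} (hα : α ∈ S.Rpos) : 0 < S.coroot α S.eta :=
  coroot_pos (fun β hβ => by rw [S.eta_pair β hβ]; exact one_pos) hα

lemma one_le_coroot_eta {α : V} (hα : α ∈ S.Rpos) : 1 ≤ S.coroot α S.eta := by
  have h := coroot_eta_pos hα
  obtain ⟨n, hn⟩ := S.coroot_int α (pos_mem hα) _ S.eta_mem_X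
  rw [hn] at h ⊢
  exact_mod_cast h

lemma base_mem : S.base ∈ S.A0 := by
  intro α hα
  have hle : S.coroot α S.eta ≤ ∑ α ∈ S.Rpos, S.coroot α S.eta :=
    Finset.single_le_sum (f := fun α => S.coroot α S.eta)
      (fun β hβ => (coroot_eta_pos hβ).le) hα
  have h := coroot_eta_pos hα
  rw [base, map_smul, smul_eq_mul, inv_mul_eq_div]
  exact ⟨div_pos h (by linarith), (div_lt_one (by linarith)).2 (by linarith)⟩

lemma lt_of_mem_A0 {x y : V} (hx : x ∈ S.A0) (hy : y ∈ S.A0) {γ : V} (hγ : γ ∈ S.R) {m : ℤ}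
    (h : S.coroot γ x < m) : S.coroot γ y < m := by
  rcases S.pos_or_neg γ hγ with hp | hp
  · have : (0 : ℝ) < m := (hx γ hp).1.trans h
    have : (1 : ℝ) ≤ m := by exact_mod_cast this
    exact (hy γ hp).2.trans_le this
  · have h1 := (hx _ hp).2
    have h2 := (hy _ hp).1
    rw [coroot_neg_apply hγ] at h1 h2
    have : (-1 : ℝ) < m := by linarith
    have : (0 : ℝ) ≤ m := by
      have : (-1 : ℤ) < m := by exact_mod_cast this
      exact_mod_cast (by omega : (0 : ℤ) ≤ m)
    linarith

lemma apply_lt_of_mem_A0 {g : V ≃ᵃ[ℝ] V} (hg : g ∈ S.extAff) {x y : V} (hx : x ∈ S.A0)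
    (hy : y ∈ S.A0) {γ : V} (hγ : γ ∈ S.R) {m : ℤ} (h : S.coroot γ (g x) < m) :
    S.coroot γ (g y) < m := by
  obtain ⟨δ, hδ, k, hk, -⟩ := transport (extAff_inv hg) hγ m
  have h1 := hk (g x)
  have h2 := hk (g y)
  rw [affine_inv_apply] at h1 h2
  have := lt_of_mem_A0 hx hy hδ (m := k) (by linarith)
  linarith

lemma lt_apply_of_mem_A0 {g : V ≃ᵃ[ℝ] V} (hg : g ∈ S.extAff) {x y : V} (hx : x ∈ S.A0)
    (hy : y ∈ S.A0) {γ : V} (hγ : γ ∈ S.R) {m : ℤ} (h : (m : ℝ) < S.coroot γ (g x)) :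
    (m : ℝ) < S.coroot γ (g y) := by
  have := apply_lt_of_mem_A0 hg hx hy (S.neg_mem γ hγ) (m := -m) (by
    rw [coroot_neg_apply hγ]; push_cast; linarith)
  rw [coroot_neg_apply hγ] at this
  push_cast at this
  linarith

variable (S) in
/-- A point of `V` lying on no affine root hyperplane. -/
def Regular (b : V) : Prop := ∀ γ ∈ S.R, ∀ m : ℤ, S.coroot γ b ≠ m

lemma Regular.apply {b : V} (hb : S.Regular b) {g : V ≃ᵃ[ℝ] V} (hg : g ∈ S.extAff) :
    S.Regular (g b) := by
  intro γ hγ m h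
  obtain ⟨δ, hδ, k, hk, -⟩ := transport (extAff_inv hg) hγ m
  have h1 := hk (g b)
  rw [affine_inv_apply] at h1
  exact hb δ hδ k (by linarith)

lemma base_regular : S.Regular S.base := by
  have key : ∀ γ ∈ S.Rpos, ∀ m : ℤ, S.coroot γ S.base ≠ m := by
    intro γ hγ m h
    obtain ⟨h1, h2⟩ := base_mem γ hγ
    rw [h] at h1 h2
    have h3 : (0 : ℤ) < m := by exact_mod_cast h1
    have h4 : m < (1 : ℤ) := by exact_mod_cast h2
    omega
  intro γ hγ m h
  rcases S.pos_or_neg γ hγ with hp | hp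
  · exact key γ hp m h
  · refine key _ hp (-m) ?_
    rw [coroot_neg_apply hγ, h]
    push_cast
    rfl

lemma apply_base_regular {g : V ≃ᵃ[ℝ] V} (hg : g ∈ S.extAff) : S.Regular (g S.base) :=
  base_regular.apply hg

lemma coroot_base_lt_one {γ : V} (hγ : γ ∈ S.R) : S.coroot γ S.base < 1 := by
  rcases S.pos_or_neg γ hγ with hp | hp
  · exact (base_mem γ hp).2
  · have := (base_mem _ hp).1
    rw [coroot_neg_apply hγ] at this
    linarith

/-! ### Separating hyperplanes and the Bruhat order -/

variable (S) in
/-- The affine roots that are negative at `a` and positive at `b`. -/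
def sep (a b : V) : Set (V × ℤ) :=
  {q | q.1 ∈ S.R ∧ S.coroot q.1 a < q.2 ∧ (q.2 : ℝ) < S.coroot q.1 b}

lemma sep_finite (a b : V) : (S.sep a b).Finite := by
  refine ((S.R : Set V).toFinite.biUnion fun γ _ => ((Set.finite_Icc ⌊S.coroot γ a⌋
    ⌈S.coroot γ b⌉).image fun m => (γ, m))).subset ?_
  rintro ⟨γ, m⟩ ⟨h1, h2, h3⟩
  simp only [Set.mem_iUnion, Set.mem_image, Set.mem_Icc]
  refine ⟨γ, h1, m, ⟨?_, ?_⟩, rfl⟩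
  · exact Int.floor_le_iff.2 (by simp only at h2; linarith)
  · exact Int.le_ceil_iff.2 (by simp only at h3; linarith)

lemma separates_iff {g : V ≃ᵃ[ℝ] V} (hg : g ∈ S.extAff) {α : V} (hα : α ∈ S.R) (n : ℤ) :
    S.Separates α n g ↔
      (S.coroot α S.base < n ∧ (n : ℝ) < S.coroot α (g S.base)) ∨
      ((n : ℝ) < S.coroot α S.base ∧ S.coroot α (g S.base) < n) := by
  have h1 : (1 : V ≃ᵃ[ℝ] V) ∈ S.extAff := by
    rw [← trans_zero (S := S)]; exact trans_mem S.X.zero_mem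
  refine or_congr (and_congr ⟨fun h => h _ base_mem, fun h x hx => ?_⟩
    ⟨fun h => h _ base_mem, fun h x hx => ?_⟩) (and_congr ⟨fun h => h _ base_mem, fun h x hx => ?_⟩
    ⟨fun h => h _ base_mem, fun h x hx => ?_⟩)
  · exact apply_lt_of_mem_A0 h1 base_mem hx hα h
  · exact lt_apply_of_mem_A0 hg base_mem hx hα h
  · exact lt_apply_of_mem_A0 h1 base_mem hx hα h
  · exact apply_lt_of_mem_A0 hg base_mem hx hα h

lemma len_eq {g : V ≃ᵃ[ℝ] V} (hg : g ∈ S.extAff) :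
    S.len g = (S.sep S.base (g S.base)).ncard := by
  refine Set.ncard_congr
    (fun q _ => if S.coroot q.1 S.base < q.2 then q else (-q.1, -q.2)) ?_ ?_ ?_
  · rintro ⟨α, n⟩ ⟨hα, h⟩
    have hα' := pos_mem hα
    simp only at hα h hα'
    rw [separates_iff hg hα'] at h
    dsimp only
    split_ifs with hlt
    · rcases h with h | h
      · exact ⟨hα', h⟩
      · linarith [h.1]
    · rcases h with h | h
      · exact absurd h.1 hlt
      · refine ⟨S.neg_mem α hα', ?_, ?_⟩ <;> simp only [coroot_neg_apply hα'] <;> push_cast <;>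
          linarith
  · rintro ⟨α, n⟩ ⟨β, m⟩ ⟨hα, -⟩ ⟨hβ, -⟩ h
    simp only at hα hβ h
    split_ifs at h
    · exact h
    · exact absurd (pos_mem hβ) (by
        have := S.pos_not_neg _ hα
        intro _
        simp only [Prod.mk.injEq] at h
        rw [h.1, neg_neg] at this
        exact this hβ)
    · exact absurd (pos_mem hα) (by
        have := S.pos_not_neg _ hβ
        intro _
        simp only [Prod.mk.injEq] at h
        rw [← h.1, neg_neg] at this
        exact this hα)
    · simpa using h
  · rintro ⟨γ, m⟩ ⟨hγ, h1, h2⟩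
    simp only at hγ h1 h2
    rcases S.pos_or_neg γ hγ with hp | hp
    · exact ⟨(γ, m), ⟨hp, (separates_iff hg hγ m).2 (Or.inl ⟨h1, h2⟩)⟩, if_pos h1⟩
    · refine ⟨(-γ, -m), ⟨hp, (separates_iff hg (pos_mem hp) _).2 (Or.inr ?_)⟩, ?_⟩
      · rw [coroot_neg_apply hγ, coroot_neg_apply hγ]
        push_cast
        constructor <;> linarith
      · rw [if_neg]
        · simp
        · simp only [coroot_neg_apply hγ]
          push_cast
          linarith

/-- Reflecting the end point away from the start point increases the number of
separating hyperplanes. -/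
lemma ncard_sep_lt {a b : V} (hb : S.Regular b) {α : V} (hα : α ∈ S.R) {n : ℤ}
    (h1 : S.coroot α a < n) (h2 : S.coroot α b < n) :
    (S.sep a b).ncard < (S.sep a (S.refl α n b)).ncard := by
  have hcr : ∀ γ ∈ S.R, ∃ c : ℤ, S.coroot γ α = c := fun γ hγ => S.crystallographic γ hγ α hα
  choose! c hc using hcr
  set ρ : V × ℤ → V × ℤ := fun q => (S.linRefl α q.1, q.2 - n * c q.1) with hρ
  have hlin : ∀ γ ∈ S.R, S.linRefl α γ ∈ S.R := fun γ hγ => (weyl_root (linRefl_mem hα) γ hγ).1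
  have hρ_apply : ∀ q : V × ℤ, q.1 ∈ S.R → ∀ x,
      S.coroot (ρ q).1 x - ((ρ q).2 : ℤ) = S.coroot q.1 (S.refl α n x) - q.2 := by
    rintro ⟨γ, m⟩ hγ x
    simp only [hρ, linRefl_apply hα, S.reflect_coroot α hα γ hγ, coroot_refl hα]
    push_cast
    rw [← hc γ hγ]
    ring
  have hρρ : ∀ q : V × ℤ, q.1 ∈ S.R → ρ (ρ q) = q := by
    rintro ⟨γ, m⟩ hγ
    have e : c (S.linRefl α γ) = -c γ := by
      have h := hc _ (hlin γ hγ)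
      rw [linRefl_apply hα, S.reflect_coroot α hα γ hγ, S.coroot_self α hα, hc γ hγ] at h
      have : (c (S.linRefl α γ) : ℝ) = -c γ := by rw [linRefl_apply hα, ← h]; ring
      exact_mod_cast this
    simp only [hρ, e, Prod.mk.injEq]
    refine ⟨?_, by ring⟩
    rw [← linear_mul_apply, linRefl_mul_self hα]; rfl
  have hin : (α, n) ∈ S.sep a (S.refl α n b) := by
    refine ⟨hα, h1, ?_⟩
    simp only [coroot_refl_self hα]
    linarith
  set φ : V × ℤ → V × ℤ :=
    fun q => if (q.2 : ℝ) < S.coroot q.1 (S.refl α n b) then q else ρ q with hφ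
  have hmaps : ∀ q ∈ S.sep a b, φ q ∈ S.sep a (S.refl α n b) \ {(α, n)} := by
    rintro ⟨γ, m⟩ ⟨hγ, h3, h4⟩
    simp only at hγ h3 h4
    simp only [hφ]
    split_ifs with h5
    · refine ⟨⟨hγ, h3, h5⟩, fun h => ?_⟩
      simp only [Set.mem_singleton_iff, Prod.mk.injEq] at h
      obtain ⟨rfl, rfl⟩ := h
      linarith
    · have h6 : S.coroot γ (S.refl α n b) < m :=
        lt_of_le_of_ne (not_lt.1 h5) (hb.apply (refl_mem hα n) γ hγ m)
      have e1 := hρ_apply (γ, m) hγ a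
      have e2 := hρ_apply (γ, m) hγ (S.refl α n b)
      rw [refl_refl hα] at e2
      simp only [coroot_refl hα] at e1 h6
      have hcpos : 0 < -S.coroot γ α := by
        by_contra! h7
        nlinarith
      refine ⟨⟨hlin γ hγ, ?_, ?_⟩, fun h => ?_⟩
      · nlinarith
      · linarith
      · have h8 : ρ (ρ (γ, m)) = ρ (α, n) := by rw [Set.mem_singleton_iff.1 h]
        rw [hρρ _ hγ] at h8
        have e3 := hρ_apply (α, n) hα a
        have e4 := hρ_apply (α, n) hα b
        rw [← h8] at e3 e4
        simp only [coroot_refl_self hα] at e3 e4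
        linarith
  have hinj : Set.InjOn φ (S.sep a b) := by
    have key : ∀ q ∈ S.sep a b, ∀ q' ∈ S.sep a b, (q.2 : ℝ) < S.coroot q.1 (S.refl α n b) →
        ¬ ((q'.2 : ℝ) < S.coroot q'.1 (S.refl α n b)) → q = ρ q' → False := by
      rintro q ⟨hq, h3, h4⟩ q' ⟨hq', h5, h6⟩ h7 h8 rfl
      have e1 := hρ_apply q' hq' a
      have e2 := hρ_apply q' hq' b
      linarith
    intro q hq q' hq' h
    simp only [hφ] at h
    split_ifs at h with h3 h4 h4
    · exact h
    · exact (key q hq q' hq' h3 h4 h).elim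
    · exact (key q' hq' q hq h4 h3 h.symm).elim
    · rw [← hρρ q hq.1, h, hρρ q' hq'.1]
  have hfin := sep_finite (S := S) a (S.refl α n b)
  calc (S.sep a b).ncard ≤ (S.sep a (S.refl α n b) \ {(α, n)}).ncard :=
        Set.ncard_le_ncard_of_injOn φ hmaps hinj hfin.sdiff
    _ < _ := Set.ncard_sdiff_singleton_lt_of_mem hin hfin

variable (S) in
/-- One step of the Bruhat order with respect to the alcove of a regular point `b`. -/
def BStep (b : V) (x y : V ≃ᵃ[ℝ] V) : Prop :=
  ∃ α ∈ S.R, ∃ n : ℤ, y = S.refl α n * x ∧ S.coroot α b < n ∧ S.coroot α (x S.base) < n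

variable (S) in
/-- The Bruhat order with respect to the alcove of a regular point `b`. -/
def BLE (b : V) : (V ≃ᵃ[ℝ] V) → (V ≃ᵃ[ℝ] V) → Prop := Relation.ReflTransGen (S.BStep b)

lemma len_lt_of_BStep {x y : V ≃ᵃ[ℝ] V} (hx : x ∈ S.extAff) (h : S.BStep S.base x y) :
    S.len x < S.len y := by
  obtain ⟨α, hα, n, rfl, h1, h2⟩ := h
  rw [len_eq hx, len_eq (extAff_mul (refl_mem hα n) hx)]
  exact ncard_sep_lt (apply_base_regular hx) hα h1 h2

lemma bruhat_step_iff {x y : V ≃ᵃ[ℝ] V} (hx : x ∈ S.extAff) :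
    ((∃ r ∈ S.affRefl, y = r * x) ∧ S.len x < S.len y) ↔ S.BStep S.base x y := by
  constructor
  · rintro ⟨⟨r, ⟨α, hα, n, hr⟩, rfl⟩, hlen⟩
    have hr : r = S.refl α n := by ext x; rw [hr, refl_apply hα]
    subst hr
    have hoff : ∀ β ∈ S.R, ∀ m : ℤ, S.refl β m = S.refl α n → S.coroot β S.base < m →
        (m : ℝ) < S.coroot β (x S.base) → False := by
      intro β hβ m hrefl h1 h2
      rw [← hrefl] at hlen
      refine absurd (len_lt_of_BStep (extAff_mul (refl_mem hβ m) hx)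
        ⟨β, hβ, m, (refl_mul_refl hβ m x).symm, h1, ?_⟩) hlen.not_gt
      rw [affine_mul_apply, coroot_refl_self hβ]
      linarith
    have hα' := S.neg_mem α hα
    have hneg : S.refl (-α) (-n) = S.refl α n := refl_neg hα n
    rcases lt_or_gt_of_ne (base_regular α hα n) with h1 | h1 <;>
      rcases lt_or_gt_of_ne (apply_base_regular hx α hα n) with h2 | h2
    · exact ⟨α, hα, n, rfl, h1, h2⟩
    · exact (hoff α hα n rfl h1 h2).elim
    · refine (hoff _ hα' _ hneg ?_ ?_).elim <;> rw [coroot_neg_apply hα] <;> push_cast <;> linarith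
    · refine ⟨-α, hα', -n, by rw [hneg], ?_, ?_⟩ <;> rw [coroot_neg_apply hα] <;> push_cast <;>
        linarith
  · intro h
    refine ⟨?_, len_lt_of_BStep hx h⟩
    obtain ⟨α, hα, n, rfl, -, -⟩ := h
    exact ⟨_, ⟨α, hα, n, refl_apply hα n⟩, rfl⟩

lemma BLE_of_bruhatLE {x y : V ≃ᵃ[ℝ] V} (hy : y ∈ S.extAff) (h : S.bruhatLE x y) :
    x ∈ S.extAff ∧ S.BLE S.base x y := by
  induction h using Relation.ReflTransGen.head_induction_on with
  | refl => exact ⟨hy, .refl⟩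
  | @head u v h _ ih =>
    obtain ⟨hv, ih⟩ := ih
    have hu : u ∈ S.extAff := by
      obtain ⟨⟨r, ⟨α, hα, n, hr⟩, rfl⟩, -⟩ := h
      have hr : r = S.refl α n := by ext x; rw [hr, refl_apply hα]
      subst hr
      rw [← refl_mul_refl hα n u]
      exact extAff_mul (refl_mem hα n) hv
    exact ⟨hu, .head ((bruhat_step_iff hu).1 h) ih⟩

lemma bruhatLE_of_BLE {x y : V ≃ᵃ[ℝ] V} (hx : x ∈ S.extAff) (h : S.BLE S.base x y) :
    S.bruhatLE x y := by
  have : y ∈ S.extAff ∧ S.bruhatLE x y := by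
    induction h with
    | refl => exact ⟨hx, .refl⟩
    | tail _ h ih =>
      obtain ⟨hu, ih⟩ := ih
      have h' := (bruhat_step_iff hu).2 h
      obtain ⟨α, hα, n, rfl, -, -⟩ := h
      exact ⟨extAff_mul (refl_mem hα n) hu, ih.tail h'⟩
  exact this.2

/-! ### Moving the base alcove across a wall -/

lemma mul_le_sq_of_crossing {x y z c A G F : ℝ} (hx : 0 < x) (hy : 0 < y) (hz : 0 < z)
    (hA : 0 < A) (hG : 0 < G) (hxy : x + y = c * z) (h1 : z ^ 2 * A ≤ x ^ 2 * G)
    (h2 : z ^ 2 * A ≤ y ^ 2 * G) (hc : c * G = 2 * F) : A * G ≤ F ^ 2 := by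
  have h3 : (z ^ 2 * A) ^ 2 ≤ (x * y * G) ^ 2 := by
    calc (z ^ 2 * A) ^ 2 = z ^ 2 * A * (z ^ 2 * A) := sq _
      _ ≤ x ^ 2 * G * (y ^ 2 * G) := mul_le_mul h1 h2 (by positivity) (by positivity)
      _ = (x * y * G) ^ 2 := by ring
  have h4 : z ^ 2 * A ≤ x * y * G :=
    (pow_le_pow_iff_left₀ (by positivity) (by positivity) two_ne_zero).1 h3
  have h5 : z ^ 2 * (4 * (A * G)) ≤ z ^ 2 * (4 * F ^ 2) := by
    calc z ^ 2 * (4 * (A * G)) = 4 * (z ^ 2 * A) * G := by ring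
      _ ≤ 4 * (x * y * G) * G := by gcongr
      _ ≤ ((x + y) * G) ^ 2 := by nlinarith [mul_nonneg (sq_nonneg (x - y)) (sq_nonneg G)]
      _ = z ^ 2 * (4 * F ^ 2) := by rw [hxy, mul_right_comm, hc]; ring
  linarith [le_of_mul_le_mul_left h5 (by positivity)]

/-- If some affine root hyperplane separates `b` from `a`, then one of these hyperplanes is
a wall of the alcove of `b`. -/
lemma exists_wall {a b : V} (h : (S.sep b a).Nonempty) :
    ∃ α n, (α, n) ∈ S.sep b a ∧ ∀ γ ∈ S.R, ∀ m : ℤ, S.coroot γ b < m →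
      (m : ℝ) < S.coroot γ (S.refl α n b) → γ = α ∧ m = n := by
  set τ : V × ℤ → ℝ := fun q => (q.2 - S.coroot q.1 b) / (S.coroot q.1 a - S.coroot q.1 b) with hτ
  set d : V × ℤ → ℝ := fun q => (q.2 - S.coroot q.1 b) ^ 2 * S.form q.1 q.1 with hd
  obtain ⟨⟨α, n⟩, hmem, hmin⟩ := Set.exists_min_image (S.sep b a)
    (fun q => toLex (τ q, d q)) (sep_finite b a) h
  refine ⟨α, n, hmem, fun γ hγ m hb hrb => ?_⟩
  obtain ⟨hα, hαb, hαa⟩ := hmem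
  simp only at hα hαb hαa
  have hlex : ∀ q ∈ S.sep b a, τ (α, n) < τ q ∨ τ (α, n) = τ q ∧ d (α, n) ≤ d q :=
    fun q hq => Prod.Lex.toLex_le_toLex.1 (hmin q hq)
  set t := τ (α, n) with ht
  have hD : 0 < S.coroot α a - S.coroot α b := by linarith
  have htα : t * (S.coroot α a - S.coroot α b) = n - S.coroot α b := by
    rw [ht, hτ]; exact div_mul_cancel₀ _ hD.ne'
  have ht0 : 0 < t := by rw [ht, hτ]; exact div_pos (by simp only; linarith) hD
  -- the value at the first crossing point of an affine root negative at `b`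
  have hcross : ∀ δ ∈ S.R, ∀ k : ℤ, S.coroot δ b < k →
      S.coroot δ b + t * (S.coroot δ a - S.coroot δ b) - k ≤ 0 ∧
      (S.coroot δ b + t * (S.coroot δ a - S.coroot δ b) - k = 0 → d (α, n) ≤ d (δ, k)) := by
    intro δ hδ k hk
    have haux : 0 ≤ S.coroot δ b + t * (S.coroot δ a - S.coroot δ b) - k →
        0 < S.coroot δ a - S.coroot δ b ∧ (δ, k) ∈ S.sep b a := by
      intro h0
      have hDδ : 0 < S.coroot δ a - S.coroot δ b := by
        by_contra! h1
        nlinarith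
      have ht1 : t < 1 := by rw [ht, hτ]; exact (div_lt_one hD).2 (by simp only; linarith)
      exact ⟨hDδ, hδ, hk, by simp only; nlinarith⟩
    have hval : 0 < S.coroot δ a - S.coroot δ b →
        τ (δ, k) * (S.coroot δ a - S.coroot δ b) = k - S.coroot δ b :=
      fun hDδ => div_mul_cancel₀ _ hDδ.ne'
    constructor
    · by_contra! h0
      obtain ⟨hDδ, hm⟩ := haux h0.le
      have h1 := hval hDδ
      have h2 : t ≤ τ (δ, k) := by
        rcases hlex _ hm with h | h
        · exact h.le
        · exact h.1.le
      nlinarith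
    · intro h0
      obtain ⟨hDδ, hm⟩ := haux h0.ge
      have h1 := hval hDδ
      rcases hlex _ hm with h | h
      · nlinarith
      · exact h.2
  obtain ⟨c, hc⟩ := S.crystallographic γ hγ α hα
  have hδ : -S.linRefl α γ ∈ S.R := S.neg_mem _ (weyl_root (linRefl_mem hα) γ hγ).1
  have hδ_apply : ∀ x, S.coroot (-S.linRefl α γ) x =
      -(S.coroot γ x - S.coroot γ α * S.coroot α x) := by
    intro x
    rw [coroot_neg_apply (weyl_root (linRefl_mem hα) γ hγ).1, linRefl_apply hα,
      S.reflect_coroot α hα γ hγ]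
  have hform : S.form (-S.linRefl α γ) (-S.linRefl α γ) = S.form γ γ := by
    rw [form_neg_left, form_comm, form_neg_left, neg_neg, form_linRefl hα]
  rw [coroot_refl hα] at hrb
  have hcpos : 0 < S.coroot γ α := by
    by_contra! h1
    nlinarith
  obtain ⟨h1, h1'⟩ := hcross γ hγ m hb
  have hδb : S.coroot (-S.linRefl α γ) b < ((c * n - m : ℤ) : ℝ) := by
    rw [hδ_apply]
    push_cast
    rw [← hc]
    linarith
  obtain ⟨h2, h2'⟩ := hcross _ hδ (c * n - m) hδb
  have hsum : S.coroot (-S.linRefl α γ) b +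
      t * (S.coroot (-S.linRefl α γ) a - S.coroot (-S.linRefl α γ) b) - ((c * n - m : ℤ) : ℝ) =
      -(S.coroot γ b + t * (S.coroot γ a - S.coroot γ b) - m) := by
    rw [hδ_apply, hδ_apply]
    push_cast
    rw [← hc]
    linear_combination S.coroot γ α * htα
  have hz : S.coroot γ b + t * (S.coroot γ a - S.coroot γ b) - m = 0 := by linarith
  have hd1 := h1' hz
  have hd2 := h2' (by rw [hsum, hz, neg_zero])
  simp only [hd, hform] at hd1 hd2
  set x := (m : ℝ) - S.coroot γ b with hx
  set y := ((c * n - m : ℤ) : ℝ) - S.coroot (-S.linRefl α γ) b with hy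
  set z := (n : ℝ) - S.coroot α b with hz'
  have hxy : x + y = S.coroot γ α * z := by
    rw [hx, hy, hz', hδ_apply]
    push_cast
    rw [← hc]
    ring
  have hx0 : 0 < x := by linarith
  have hy0 : 0 < y := by linarith
  have hz0 : 0 < z := by linarith
  have hkey := mul_le_sq_of_crossing hx0 hy0 hz0 (form_self_pos hα) (form_self_pos hγ) hxy hd1 hd2
    (coroot_mul_form hγ α)
  rw [form_comm γ α] at hkey
  have hγα := eq_of_form_ge hα hγ hcpos hkey
  refine ⟨hγα, ?_⟩
  subst hγα
  have : (m : ℝ) = n := by linarith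
  exact_mod_cast this

lemma BStep.translate {b : V} {x y : V ≃ᵃ[ℝ] V} (h : S.BStep b x y) {g : V ≃ᵃ[ℝ] V}
    (hg : g ∈ S.extAff) : S.BStep (g b) (g * x) (g * y) := by
  obtain ⟨α, hα, n, rfl, h1, h2⟩ := h
  obtain ⟨δ, hδ, k, hk, hcomm⟩ := transport hg hα n
  refine ⟨δ, hδ, k, by rw [← mul_assoc, hcomm, mul_assoc], ?_, ?_⟩
  · linarith [hk b]
  · rw [affine_mul_apply]
    linarith [hk (x S.base)]

lemma BLE.translate {b : V} {x y : V ≃ᵃ[ℝ] V} (h : S.BLE b x y) {g : V ≃ᵃ[ℝ] V}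
    (hg : g ∈ S.extAff) : S.BLE (g b) (g * x) (g * y) := by
  induction h with
  | refl => exact .refl
  | tail _ h ih => exact ih.tail (h.translate hg)

/-- The lifting property of the Bruhat order. -/
lemma BLE.lifting {b : V} (hb : S.Regular b) {α : V} (hα : α ∈ S.R) {n : ℤ}
    (hwall : ∀ γ ∈ S.R, ∀ m : ℤ, S.coroot γ b < m →
      (m : ℝ) < S.coroot γ (S.refl α n b) → γ = α ∧ m = n)
    {x y : V ≃ᵃ[ℝ] V} (h : S.BLE b x y) :
    S.BLE b (S.refl α n * x) (S.refl α n * y) ∨ S.BLE b x (S.refl α n * y) := by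
  induction h with
  | refl => exact Or.inl .refl
  | @tail y z hxy hyz ih =>
    obtain ⟨γ, hγ, m, rfl, h1, h2⟩ := hyz
    by_cases heq : γ = α ∧ m = n
    · obtain ⟨rfl, rfl⟩ := heq
      right
      rwa [refl_mul_refl hγ]
    · have h3 : S.coroot γ (S.refl α n b) < m :=
        lt_of_le_of_ne (not_lt.1 fun h => heq (hwall γ hγ m h1 h))
          (hb.apply (refl_mem hα n) γ hγ m)
      have h4 : S.BStep (S.refl α n b) y (S.refl γ m * y) := ⟨γ, hγ, m, rfl, h3, h2⟩
      have h5 := h4.translate (refl_mem hα n)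
      rw [refl_refl hα] at h5
      exact ih.imp (fun h => h.tail h5) fun h => h.tail h5

/-- The Bruhat order is unchanged when the base alcove is moved towards its lower bound. -/
lemma BLE.move {a b : V} (ha : S.Regular a) (hb : S.Regular b) {x y : V ≃ᵃ[ℝ] V}
    (hsep : ∀ q ∈ S.sep b a, (q.2 : ℝ) < S.coroot q.1 (x S.base)) (h : S.BLE b x y) :
    S.BLE a x y := by
  induction hN : (S.sep b a).ncard using Nat.strong_induction_on generalizing b with
  | _ N ih =>
  rcases (S.sep b a).eq_empty_or_nonempty with hemp | hne
  · suffices hstep : ∀ u v, S.BStep b u v → S.BStep a u v by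
      clear ih hsep
      induction h with
      | refl => exact .refl
      | tail _ h ih => exact ih.tail (hstep _ _ h)
    rintro u v ⟨γ, hγ, m, rfl, h1, h2⟩
    refine ⟨γ, hγ, m, rfl, ?_, h2⟩
    refine lt_of_le_of_ne (not_lt.1 fun h3 => ?_) (ha γ hγ m)
    have : (γ, m) ∈ S.sep b a := ⟨hγ, h1, h3⟩
    rw [hemp] at this
    exact this
  · obtain ⟨α, n, hmem, hwall⟩ := exists_wall hne
    have hα : α ∈ S.R := hmem.1
    have hαb : S.coroot α b < n := hmem.2.1
    have hαa : (n : ℝ) < S.coroot α a := hmem.2.2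
    have hsub : S.sep (S.refl α n b) a ⊆ S.sep b a \ {(α, n)} := by
      rintro ⟨γ, m⟩ ⟨hγ, h1, h2⟩
      simp only at hγ h1 h2
      refine ⟨⟨hγ, ?_, h2⟩, fun h3 => ?_⟩
      · refine lt_of_le_of_ne (not_lt.1 fun h3 => ?_) (hb γ hγ m)
        obtain ⟨h4, h5⟩ := hwall (-γ) (S.neg_mem γ hγ) (-m)
          (by rw [coroot_neg_apply hγ]; push_cast; linarith)
          (by rw [coroot_neg_apply hγ]; push_cast; linarith)
        rw [← h4, ← h5, coroot_neg_apply hγ] at hαa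
        push_cast at hαa
        linarith
      · simp only [Set.mem_singleton_iff, Prod.mk.injEq] at h3
        obtain ⟨rfl, rfl⟩ := h3
        rw [coroot_refl_self hγ] at h1
        linarith
    have hx := hsep _ hmem
    refine ih _ ?_ (hb.apply (refl_mem hα n)) (fun q hq => hsep q (hsub hq).1) ?_ rfl
    · rw [← hN]
      exact (Set.ncard_le_ncard hsub (sep_finite b a).sdiff).trans_lt
        (Set.ncard_sdiff_singleton_lt_of_mem hmem (sep_finite b a))
    · have h1 : S.BLE b (S.refl α n * x) (S.refl α n * y) := by
        refine (BLE.lifting hb hα hwall h).elim id fun h2 => .head ?_ h2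
        refine ⟨α, hα, n, (refl_mul_refl hα n x).symm, hαb, ?_⟩
        rw [affine_mul_apply, coroot_refl_self hα]
        simp only at hx
        linarith
      have h2 := h1.translate (refl_mem hα n)
      rwa [refl_mul_refl hα, refl_mul_refl hα] at h2

/-! ### Simple reflections and chains in the finite Weyl group -/

lemma linRefl_simple_sub {α β : V} (hα : α ∈ S.R) {c d : V → ℕ}
    (hc : β = ∑ γ ∈ S.Δ, (c γ : ℝ) • γ) (hd : S.linRefl α β = ∑ γ ∈ S.Δ, (d γ : ℝ) • γ) :
    ∑ γ ∈ S.Δ, ((c γ : ℝ) - d γ) • γ = S.coroot α β • α := by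
  simp only [sub_smul, Finset.sum_sub_distrib]
  rw [← hc, ← hd, linRefl_apply hα]
  abel

lemma coeff_of_sum_eq {α : V} (hα : α ∈ S.Δ) {a : V → ℝ} {m : ℝ}
    (h : ∑ γ ∈ S.Δ, a γ • γ = m • α) : a α = m ∧ ∀ γ ∈ S.Δ, γ ≠ α → a γ = 0 := by
  have h0 : ∑ γ ∈ S.Δ, (a γ - if γ = α then m else 0) • γ = 0 := by
    simp only [sub_smul, Finset.sum_sub_distrib, h, ite_smul, zero_smul]
    rw [Finset.sum_ite_eq' S.Δ α, if_pos hα, sub_self]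
  rw [← Finset.sum_coe_sort] at h0
  have h1 := Fintype.linearIndependent_iff.1 S.simple_indep
    (fun γ => a γ - if (γ : V) = α then m else 0) h0
  refine ⟨?_, fun γ hγ hne => ?_⟩
  · have := h1 ⟨α, hα⟩
    simp only [if_true] at this
    linarith
  · have := h1 ⟨γ, hγ⟩
    simp only [if_neg hne] at this
    linarith

/-- A simple reflection permutes the other positive roots. -/
lemma linRefl_simple_pos {α β : V} (hα : α ∈ S.Δ) (hβ : β ∈ S.Rpos) (hne : β ≠ α) :
    S.linRefl α β ∈ S.Rpos := by
  have hαR := simple_mem hα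
  have hmem := (weyl_root (linRefl_mem hαR) β (pos_mem hβ)).1
  refine (S.pos_or_neg _ hmem).resolve_right fun hneg => hne ?_
  obtain ⟨c, hc⟩ := S.pos_sum_simple β hβ
  obtain ⟨d, hd⟩ := S.pos_sum_simple _ hneg
  have h : ∑ γ ∈ S.Δ, ((c γ : ℝ) + d γ) • γ = S.coroot α β • α := by
    simp only [add_smul, Finset.sum_add_distrib]
    rw [← hc, ← hd, linRefl_apply hαR]
    abel
  have h0 := (coeff_of_sum_eq hα h).2
  have hβα : β = (c α : ℝ) • α := by
    rw [hc]
    refine Finset.sum_eq_single α (fun γ hγ hγα => ?_) fun h => (h hα).elim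
    have h1 := h0 γ hγ hγα
    have h2 : (c γ : ℝ) = 0 := le_antisymm (by linarith [(d γ).cast_nonneg (α := ℝ)]) (by positivity)
    rw [h2, zero_smul]
  rcases S.reduced α hαR (c α) (hβα ▸ pos_mem hβ) with h1 | h1
  · rw [hβα, h1, one_smul]
  · linarith [(c α).cast_nonneg (α := ℝ)]

lemma linRefl_conj {w : V ≃ₗ[ℝ] V} (hw : w ∈ S.Weyl) {β : V} (hβ : β ∈ S.R) :
    S.linRefl (w β) * w = w * S.linRefl β := by
  obtain ⟨h1, h2⟩ := weyl_root hw β hβ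
  ext x
  rw [linear_mul_apply, linear_mul_apply, linRefl_apply h1, linRefl_apply hβ, h2, map_sub, map_smul]

variable (S) in
/-- An increasing step in the finite Weyl group: left multiplication by the reflection in a
positive root `β` with `x⁻¹ β` positive. -/
def WStep (x y : V ≃ₗ[ℝ] V) : Prop :=
  x ∈ S.Weyl ∧ ∃ β ∈ S.Rpos, x⁻¹ β ∈ S.Rpos ∧ y = S.linRefl β * x

lemma wchain_simple {α : V} (hα : α ∈ S.Δ) {w : V ≃ₗ[ℝ] V}
    (h : Relation.ReflTransGen S.WStep 1 w) :
    Relation.ReflTransGen S.WStep 1 (S.linRefl α * w) := by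
  have hαR := simple_mem hα
  induction h with
  | refl => exact .single ⟨S.Weyl.one_mem, α, simple_pos hα, simple_pos hα, rfl⟩
  | @tail x y hx hxy ih =>
    obtain ⟨hxW, β, hβ, hxβ, rfl⟩ := hxy
    by_cases hne : β = α
    · rwa [hne, ← mul_assoc, linRefl_mul_self hαR, one_mul]
    · refine ih.tail ⟨S.Weyl.mul_mem (linRefl_mem hαR) hxW, _, linRefl_simple_pos hα hβ hne, ?_, ?_⟩
      · rwa [mul_inv_rev, linear_mul_apply, linear_inv_apply]
      · rw [← mul_assoc, ← mul_assoc, linRefl_conj (linRefl_mem hαR) (pos_mem hβ)]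

lemma wchain_pos {β : V} (hβ : β ∈ S.Rpos) {w : V ≃ₗ[ℝ] V}
    (h : Relation.ReflTransGen S.WStep 1 w) :
    Relation.ReflTransGen S.WStep 1 (S.linRefl β * w) := by
  obtain ⟨c, hc⟩ := S.pos_sum_simple β hβ
  induction hN : ∑ γ ∈ S.Δ, c γ using Nat.strong_induction_on generalizing β w c with
  | _ N ih =>
  by_cases hβΔ : β ∈ S.Δ
  · exact wchain_simple hβΔ h
  have hβR := pos_mem hβ
  obtain ⟨α, hα, hpos⟩ : ∃ α ∈ S.Δ, 0 < S.coroot β α := by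
    by_contra! h1
    have h2 := S.coroot_self β hβR
    nth_rw 2 [hc] at h2
    rw [map_sum] at h2
    have : ∑ γ ∈ S.Δ, S.coroot β ((c γ : ℝ) • γ) ≤ 0 := by
      refine Finset.sum_nonpos fun γ hγ => ?_
      rw [map_smul, smul_eq_mul]
      exact mul_nonpos_of_nonneg_of_nonpos (by positivity) (h1 γ hγ)
    linarith
  have hαR := simple_mem hα
  have hpos' : 0 < S.coroot α β := by
    have h1 := coroot_mul_form hβR α
    have h2 := coroot_mul_form hαR β
    rw [form_comm β α, ← h2] at h1
    exact pos_of_mul_pos_left (h1 ▸ mul_pos hpos (form_self_pos hβR)) (form_self_pos hαR).le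
  have hβ' := linRefl_simple_pos hα hβ fun h => hβΔ (h ▸ hα)
  obtain ⟨d, hd⟩ := S.pos_sum_simple _ hβ'
  have hlt : ∑ γ ∈ S.Δ, d γ < N := by
    obtain ⟨h1, h2⟩ := coeff_of_sum_eq hα (linRefl_simple_sub hαR hc hd)
    rw [← hN]
    refine Finset.sum_lt_sum (fun γ hγ => ?_) ⟨α, hα, ?_⟩
    · by_cases hγα : γ = α
      · have : (d γ : ℝ) ≤ c γ := by rw [hγα]; linarith
        exact_mod_cast this
      · have : (d γ : ℝ) ≤ c γ := by linarith [h2 γ hγ hγα]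
        exact_mod_cast this
    · have : (d α : ℝ) < c α := by linarith
      exact_mod_cast this
  have h1 := wchain_simple hα (ih _ hlt hβ' (wchain_simple hα h) d hd rfl)
  have h2 := linRefl_conj (linRefl_mem hαR) (pos_mem hβ')
  rw [← linear_mul_apply, linRefl_mul_self hαR, LinearEquiv.coe_one, id] at h2
  rwa [← mul_assoc, ← h2, mul_assoc, ← mul_assoc (S.linRefl α), linRefl_mul_self hαR, one_mul] at h1

lemma wchain {w : V ≃ₗ[ℝ] V} (hw : w ∈ S.Weyl) : Relation.ReflTransGen S.WStep 1 w := by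
  refine weyl_induction .refl (fun α hα v _ hv => ?_) hw
  rcases S.pos_or_neg α hα with hp | hp
  · exact wchain_pos hp hv
  · have : S.linRefl (-α) = S.linRefl α := by
      ext x
      rw [linRefl_apply hα, linRefl_apply (S.neg_mem α hα), coroot_neg_apply hα, smul_neg, neg_smul,
        neg_neg]
    exact this ▸ wchain_pos hp hv

lemma w0_mem_Weyl : S.w0 ∈ S.Weyl := S.w0_mem

lemma w0_inv_neg {α : V} (hα : α ∈ S.Rpos) : -(S.w0⁻¹ α) ∈ S.Rpos := by
  have hm := (weyl_root (S.Weyl.inv_mem w0_mem_Weyl) α (pos_mem hα)).1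
  refine (S.pos_or_neg _ hm).resolve_left fun h => S.pos_not_neg α hα ?_
  have := S.w0_neg _ h
  rwa [linear_apply_inv] at this

variable (S) in
/-- The element `z` maps the base alcove to a dominant alcove. -/
def Dom (z : V ≃ᵃ[ℝ] V) : Prop := ∀ α ∈ S.Rpos, 0 < S.coroot α (z S.base)

lemma exists_dom {g : V ≃ᵃ[ℝ] V} (hg : g ∈ S.extAff) : ∃ v ∈ S.Weyl, S.Dom (S.ofW v * g) := by
  induction hN : (S.Rpos.filter fun γ => S.coroot γ (g S.base) < 0).card using
    Nat.strong_induction_on generalizing g with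
  | _ N ih =>
  by_cases hall : ∀ α ∈ S.Δ, 0 < S.coroot α (g S.base)
  · exact ⟨1, S.Weyl.one_mem, fun α hα => coroot_pos hall hα⟩
  push Not at hall
  obtain ⟨α, hα, hle⟩ := hall
  have hαR := simple_mem hα
  have hlt : S.coroot α (g S.base) < 0 :=
    lt_of_le_of_ne hle (by simpa using apply_base_regular hg α hαR 0)
  have hval : ∀ γ ∈ S.R, S.coroot γ ((S.ofW (S.linRefl α) * g) S.base) =
      S.coroot (S.linRefl α γ) (g S.base) := by
    intro γ hγ
    rw [← (weyl_root (linRefl_mem hαR) _ (weyl_root (linRefl_mem hαR) γ hγ).1).2 (g S.base),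
      ← linear_mul_apply, linRefl_mul_self hαR]
    rfl
  have hinv : ∀ x, S.linRefl α (S.linRefl α x) = x := fun x => by
    rw [← linear_mul_apply, linRefl_mul_self hαR]; rfl
  have hself : S.linRefl α α = -α := by
    rw [linRefl_apply hαR, S.coroot_self α hαR]; module
  have hcard : (S.Rpos.filter fun γ =>
      S.coroot γ ((S.ofW (S.linRefl α) * g) S.base) < 0).card < N := by
    rw [← hN]
    have hmem : α ∈ S.Rpos.filter fun γ => S.coroot γ (g S.base) < 0 :=
      Finset.mem_filter.2 ⟨simple_pos hα, hlt⟩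
    refine lt_of_le_of_lt ?_ (Finset.card_erase_lt_of_mem hmem)
    refine Finset.card_le_card_of_injOn (S.linRefl α) ?_ (S.linRefl α).injective.injOn
    intro γ hγ
    obtain ⟨hγ, hneg⟩ := Finset.mem_filter.1 (Finset.mem_coe.1 hγ)
    rw [hval γ (pos_mem hγ)] at hneg
    have hne : γ ≠ α := by
      rintro rfl
      rw [hself, coroot_neg_apply hαR] at hneg
      linarith
    refine Finset.mem_coe.2 (Finset.mem_erase.2 ⟨fun h => ?_, Finset.mem_filter.2
      ⟨linRefl_simple_pos hα hγ hne, hneg⟩⟩)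
    have h1 := hinv γ
    rw [h, hself] at h1
    exact S.pos_not_neg α (simple_pos hα) (h1 ▸ hγ)
  obtain ⟨v, hv, hdom⟩ := ih _ hcard (extAff_mul (ofW_mem (linRefl_mem hαR)) hg) rfl
  refine ⟨v * S.linRefl α, S.Weyl.mul_mem hv (linRefl_mem hαR), ?_⟩
  rwa [ofW_mul, mul_assoc]

/-! ### The up-arrow order -/

variable (S) in
/-- One step of the up-arrow order. -/
def UpStep (x y : V ≃ᵃ[ℝ] V) : Prop :=
  ∃ α ∈ S.Rpos, ∃ n : ℤ, y = S.refl α n * x ∧ S.coroot α (x S.base) < n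

variable (S) in
/-- The up-arrow order, tested at the point `base` of the base alcove. -/
def Up : (V ≃ᵃ[ℝ] V) → (V ≃ᵃ[ℝ] V) → Prop := Relation.ReflTransGen S.UpStep

lemma Up_of_upLE {x y : V ≃ᵃ[ℝ] V} (h : S.upLE x y) : S.Up x y := by
  induction h with
  | refl => exact .refl
  | tail _ h ih =>
    obtain ⟨α, hα, n, h1, h2⟩ := h
    exact ih.tail ⟨α, hα, n, by ext x; rw [h1, affine_mul_apply, refl_apply (pos_mem hα)],
      h2 _ base_mem⟩

lemma upLE_of_Up {x y : V ≃ᵃ[ℝ] V} (hx : x ∈ S.extAff) (h : S.Up x y) : S.upLE x y := by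
  have : y ∈ S.extAff ∧ S.upLE x y := by
    induction h with
    | refl => exact ⟨hx, .refl⟩
    | tail _ h ih =>
      obtain ⟨hu, ih⟩ := ih
      obtain ⟨α, hα, n, rfl, h⟩ := h
      have hαR := pos_mem hα
      exact ⟨extAff_mul (refl_mem hαR n) hu, ih.tail ⟨α, hα, n, fun x => refl_apply hαR n _,
        fun x hx => apply_lt_of_mem_A0 hu base_mem hx hαR h⟩⟩
  exact this.2

lemma Up.trans_mul {ν : V} (hν : ν ∈ S.X) {x y : V ≃ᵃ[ℝ] V} (h : S.Up x y) :
    S.Up (S.trans ν * x) (S.trans ν * y) := by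
  induction h with
  | refl => exact .refl
  | tail _ h ih =>
    obtain ⟨α, hα, n, rfl, h⟩ := h
    obtain ⟨k, hk⟩ := S.coroot_int α (pos_mem hα) ν hν
    refine ih.tail ⟨α, hα, n + k, ?_, ?_⟩
    · rw [← mul_assoc, trans_mul_refl (pos_mem hα) hk, mul_assoc]
    · rw [affine_mul_apply, trans_apply, map_add, hk]
      push_cast
      linarith

/-- An element of the Weyl group making all positive roots negative reverses the order. -/
lemma Up.reverse {g : V ≃ₗ[ℝ] V} (hg : g ∈ S.Weyl) (hneg : ∀ α ∈ S.Rpos, -(g α) ∈ S.Rpos)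
    {x y : V ≃ᵃ[ℝ] V} (h : S.Up x y) : S.Up (S.ofW g * y) (S.ofW g * x) := by
  induction h with
  | refl => exact .refl
  | @tail y z _ h ih =>
    obtain ⟨α, hα, n, rfl, h⟩ := h
    have hαR := pos_mem hα
    obtain ⟨h1, h2⟩ := weyl_root hg α hαR
    refine .head ⟨-(g α), hneg α hα, -n, ?_, ?_⟩ ih
    · rw [refl_neg h1, ← mul_assoc, ← ofW_mul_refl hg hαR, mul_assoc, refl_mul_refl hαR]
    · rw [coroot_neg_apply h1, affine_mul_apply, ofW_apply, h2, affine_mul_apply,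
        coroot_refl_self hαR]
      push_cast
      linarith

lemma Up.neg_smul {β : V} (hβ : β ∈ S.Rpos) (n : ℕ) {x : V ≃ᵃ[ℝ] V} (hx : x ∈ S.extAff) :
    S.Up (S.trans (-(n : ℝ) • β) * x) x := by
  have hβR := pos_mem hβ
  induction n with
  | zero =>
    rw [Nat.cast_zero, neg_zero, zero_smul, trans_zero, one_mul]
    exact .refl
  | succ n ih =>
    refine .trans ?_ ih
    set y := S.trans (-(n : ℝ) • β) * x with hy
    have hyX : y ∈ S.extAff := by
      refine extAff_mul (trans_mem ?_) hx
      have := intSmul_root_mem hβR (-(n : ℤ))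
      rwa [Int.cast_neg, Int.cast_natCast] at this
    have e : S.trans (-((n + 1 : ℕ) : ℝ) • β) * x = S.trans (-β) * y := by
      rw [hy, ← mul_assoc, ← trans_add]
      congr 2
      push_cast
      module
    set k := ⌊S.coroot β (y S.base)⌋ with hk
    have hlt : (k : ℝ) < S.coroot β (y S.base) :=
      lt_of_le_of_ne (Int.floor_le _) (apply_base_regular hyX β hβR k).symm
    have hlt' := Int.lt_floor_add_one (S.coroot β (y S.base))
    have hval : S.coroot β ((S.trans (-β) * y) S.base) = S.coroot β (y S.base) - 2 := by
      rw [affine_mul_apply, trans_apply, map_add, map_neg, S.coroot_self β hβR]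
      ring
    rw [e]
    refine .head (b := S.refl β (k - 1) * (S.trans (-β) * y)) ⟨β, hβ, k - 1, rfl, ?_⟩ <|
      .single ⟨β, hβ, k, ?_, ?_⟩
    · rw [hval]
      push_cast
      linarith
    · ext z
      simp only [affine_mul_apply, trans_apply, refl_apply hβR, map_add, map_sub, map_smul, map_neg,
        S.coroot_self β hβR, smul_eq_mul]
      push_cast
      module
    · rw [affine_mul_apply, coroot_refl_self hβR, hval]
      push_cast
      linarith

lemma refl_zero (α : V) : S.refl α 0 = S.ofW (S.linRefl α) := by
  rw [refl, Int.cast_zero, zero_smul, trans_zero, one_mul]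

lemma WStep.coroot_lt {z : V ≃ᵃ[ℝ] V} (hz : S.Dom z) {x : V ≃ₗ[ℝ] V} (hx : x ∈ S.Weyl) {β : V}
    (hβ : β ∈ S.Rpos) (hxβ : x⁻¹ β ∈ S.Rpos) :
    S.coroot β ((S.ofW (S.linRefl β * x) * z) S.base) < 0 := by
  have hβR := pos_mem hβ
  have h1 := coroot_weyl hx (pos_mem hxβ) (x (z S.base))
  rw [linear_apply_inv, linear_inv_apply] at h1
  have h2 := coroot_refl_self hβR 0 (x (z S.base))
  rw [refl_zero, ofW_apply, h1, Int.cast_zero, mul_zero, zero_sub] at h2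
  exact h2.trans_lt (neg_lt_zero.2 (hz _ hxβ))

lemma Dom.up {z : V ≃ᵃ[ℝ] V} (hz : S.Dom z) {w : V ≃ₗ[ℝ] V} (hw : w ∈ S.Weyl) :
    S.Up (S.ofW w * z) z := by
  induction wchain hw with
  | refl => exact .refl
  | @tail x y _ h ih =>
    obtain ⟨hx, β, hβ, hxβ, rfl⟩ := h
    refine .head ⟨β, hβ, 0, ?_, ?_⟩ (ih hx)
    · rw [refl_zero, ← mul_assoc, ← ofW_mul, ← mul_assoc, linRefl_mul_self (pos_mem hβ), one_mul]
    · rw [Int.cast_zero]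
      exact WStep.coroot_lt hz hx hβ hxβ

/-- `w₀ z` is the largest element of `W z` in the Bruhat order, for `z` dominant. -/
lemma Dom.bruhat {z : V ≃ᵃ[ℝ] V} (hz : S.Dom z) {v : V ≃ₗ[ℝ] V} (hv : v ∈ S.Weyl) :
    S.BLE S.base (S.ofW v * z) (S.ofW S.w0 * z) := by
  have key : ∀ x : V ≃ₗ[ℝ] V, x ∈ S.Weyl →
      S.BLE S.base (S.ofW (S.w0 * x) * z) (S.ofW S.w0 * z) := by
    intro y hy
    induction wchain hy with
    | refl => exact .refl
    | @tail x y _ h ih =>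
      obtain ⟨hx, β, hβ, hxβ, rfl⟩ := h
      have hβR := pos_mem hβ
      obtain ⟨h1, h2⟩ := weyl_root w0_mem_Weyl β hβR
      refine .head ⟨S.w0 β, h1, 0, ?_, ?_, ?_⟩ (ih hx)
      · rw [refl_zero, ← mul_assoc, ← ofW_mul, ← mul_assoc, linRefl_conj w0_mem_Weyl hβR,
          mul_assoc, ← mul_assoc (S.linRefl β), linRefl_mul_self hβR, one_mul]
      · have := (base_mem _ (S.w0_neg β hβ)).1
        rw [coroot_neg_apply h1] at this
        rw [Int.cast_zero]
        linarith
      · rw [Int.cast_zero, ofW_mul, mul_assoc, affine_mul_apply, ofW_apply, h2]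
        exact WStep.coroot_lt hz hx hβ hxβ
  have := key (S.w0⁻¹ * v) (S.Weyl.mul_mem (S.Weyl.inv_mem w0_mem_Weyl) hv)
  rwa [mul_inv_cancel_left] at this

lemma up_trans_eta {y : V ≃ᵃ[ℝ] V} (hy : y ∈ S.extAff) {w : V ≃ₗ[ℝ] V} (hw : w ∈ S.Weyl) :
    S.Up (S.trans (w S.eta) * y) (S.trans S.eta * y) := by
  induction wchain hw with
  | refl => exact .refl
  | @tail x w _ h ih =>
    obtain ⟨hx, β, hβ, hxβ, rfl⟩ := h
    have hβR := pos_mem hβ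
    refine .trans ?_ (ih hx)
    have hxη := weyl_X hx _ S.eta_mem_X
    obtain ⟨n, hn⟩ := S.coroot_int β hβR _ hxη
    have h1 : 0 < S.coroot β (x S.eta) := by
      have h1 := coroot_weyl hx (pos_mem hxβ) (x S.eta)
      rw [linear_apply_inv, linear_inv_apply] at h1
      rw [h1]
      exact coroot_eta_pos hxβ
    rw [hn] at h1
    lift n to ℕ using by exact_mod_cast h1.le
    have h2 := Up.neg_smul hβ n (extAff_mul (trans_mem hxη) hy)
    rw [← mul_assoc, ← trans_add] at h2
    have e : (S.linRefl β * x) S.eta = -(n : ℝ) • β + x S.eta := by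
      rw [linear_mul_apply, linRefl_apply hβR, hn, Int.cast_natCast]
      module
    rwa [e]

/-! ### Bounds in the up-arrow order and the admissible set -/

lemma up_of_BLE {F : (V ≃ₗ[ℝ] V) → (V ≃ᵃ[ℝ] V)}
    (hF : ∀ w ∈ S.Weyl, ∀ β ∈ S.Rpos, ∀ k : ℤ, (k : ℝ) < S.coroot β (w S.base) →
      S.Up (S.trans ((k : ℝ) • β) * F (S.linRefl β * w)) (F w))
    {x z : V ≃ᵃ[ℝ] V} (hx : x ∈ S.extAff) (h : S.BLE S.base x z)
    (hz : ∀ w ∈ S.Weyl, S.Up (S.ofW w * z) (F w)) :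
    ∀ w ∈ S.Weyl, S.Up (S.ofW w * x) (F w) := by
  induction h using Relation.ReflTransGen.head_induction_on with
  | refl => exact hz
  | @head x z h _ ih =>
    obtain ⟨α, hα, n, rfl, h1, h2⟩ := h
    intro w hw
    have hzX := extAff_mul (refl_mem hα n) hx
    have ih := ih hzX
    obtain ⟨hβ, hβw⟩ := weyl_root hw α hα
    have hwx : S.ofW w * (S.refl α n * x) = S.refl (w α) n * (S.ofW w * x) := by
      rw [← mul_assoc, ofW_mul_refl hw hα, mul_assoc]
    rcases S.pos_or_neg _ hβ with hp | hp
    · refine .head ⟨w α, hp, n, hwx, ?_⟩ (ih w hw)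
      rwa [affine_mul_apply, ofW_apply, hβw]
    · have hpR := pos_mem hp
      set β := -(w α) with hβdef
      have hlt : ((-n : ℤ) : ℝ) < S.coroot β (w S.base) := by
        rw [coroot_neg_apply hβ, hβw]
        push_cast
        linarith
      set k := ⌈S.coroot β (w S.base)⌉ - 1 with hk
      have hk1 : (k : ℝ) < S.coroot β (w S.base) := by
        have := Int.ceil_lt_add_one (S.coroot β (w S.base))
        rw [hk]
        push_cast
        linarith
      obtain ⟨m, hm⟩ : ∃ m : ℕ, (m : ℤ) = k + n := by
        refine ⟨(k + n).toNat, Int.toNat_of_nonneg ?_⟩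
        have := Int.lt_ceil.2 hlt
        omega
      have hlin := linRefl_mem hpR
      have hsX := extAff_mul (trans_mem (intSmul_root_mem hpR k))
        (extAff_mul (ofW_mem (S.Weyl.mul_mem hlin hw)) hzX)
      have e : S.ofW w * x = S.trans (-(m : ℝ) • β) *
          (S.trans ((k : ℝ) • β) * (S.ofW (S.linRefl β * w) * (S.refl α n * x))) := by
        have h3 : -(m : ℝ) • β + (k : ℝ) • β = ((-n : ℤ) : ℝ) • β := by
          have : (m : ℝ) = k + n := by exact_mod_cast hm
          rw [this, ← add_smul]
          congr 1
          push_cast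
          ring
        rw [ofW_mul, mul_assoc (S.ofW (S.linRefl β)), hwx, ← mul_assoc (S.trans _) (S.trans _),
          ← trans_add, h3, ← mul_assoc, ← refl, refl_neg hβ, refl_mul_refl hβ]
      rw [e]
      refine (Up.neg_smul hp m hsX).trans (.trans ?_ (hF w hw β hp k hk1))
      exact (ih _ (S.Weyl.mul_mem hlin hw)).trans_mul (intSmul_root_mem hpR k)

lemma up_of_mem_Adm {h : V ≃ᵃ[ℝ] V} (hh : h ∈ S.Adm S.eta) {w : V ≃ₗ[ℝ] V} (hw : w ∈ S.Weyl) :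
    S.Up (S.ofW w * h) (S.trans S.eta * S.ofW w) := by
  obtain ⟨σ, hσ, hle⟩ := hh
  obtain ⟨hhX, hle⟩ := BLE_of_bruhatLE (trans_mem (weyl_X hσ _ S.eta_mem_X)) hle
  refine up_of_BLE (F := fun w => S.trans S.eta * S.ofW w) ?_ hhX hle ?_ w hw
  · intro w _ β hβ k hk
    have hβR := pos_mem hβ
    have e : S.trans ((k : ℝ) • β) * (S.trans S.eta * S.ofW (S.linRefl β * w)) =
        S.trans S.eta * (S.refl β k * S.ofW w) := by
      rw [refl, ofW_mul, ← mul_assoc, ← trans_add, add_comm, trans_add]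
      simp only [mul_assoc]
    rw [e]
    refine Up.trans_mul S.eta_mem_X (.single ⟨β, hβ, k, (refl_mul_refl hβR k _).symm, ?_⟩)
    rw [affine_mul_apply, coroot_refl_self hβR, ofW_apply]
    linarith
  · intro w hw
    rw [ofW_mul_trans]
    exact up_trans_eta (ofW_mem hw) (S.Weyl.mul_mem hw hσ)

lemma Dom.up_of_bruhatLE {z g : V ≃ᵃ[ℝ] V} (hz : S.Dom z) (hg : g ∈ S.extAff)
    (h : S.BLE S.base g (S.ofW S.w0 * z)) (hzX : z ∈ S.extAff) {w : V ≃ₗ[ℝ] V}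
    (hw : w ∈ S.Weyl) : S.Up (S.ofW w * g) z := by
  refine up_of_BLE (F := fun _ => z) ?_ hg h ?_ w hw
  · intro w hw β hβ k hk
    have h1 := coroot_weyl hw (weyl_root (S.Weyl.inv_mem hw) β (pos_mem hβ)).1 (w S.base)
    rw [linear_apply_inv, linear_inv_apply] at h1
    have h2 := coroot_base_lt_one (weyl_root (S.Weyl.inv_mem hw) β (pos_mem hβ)).1
    have h3 : k < 1 := by
      have : (k : ℝ) < 1 := by linarith
      exact_mod_cast this
    obtain ⟨m, rfl⟩ : ∃ m : ℕ, k = -m := ⟨(-k).toNat, by omega⟩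
    push_cast
    exact Up.neg_smul hβ m hzX
  · intro w hw
    rw [← mul_assoc, ← ofW_mul]
    exact hz.up (S.Weyl.mul_mem hw w0_mem_Weyl)

/-- The up-arrow order is the Bruhat order for a base alcove that is sufficiently far away in the
antidominant direction. -/
lemma Up.exists_BLE {x y : V ≃ᵃ[ℝ] V} (h : S.Up x y) :
    ∃ N : ℕ, ∀ M : ℕ, N ≤ M → S.BLE (S.trans (-((M : ℝ) • S.eta)) S.base) x y := by
  induction h with
  | refl => exact ⟨0, fun _ _ => .refl⟩
  | tail _ h ih =>
    obtain ⟨N, hN⟩ := ih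
    obtain ⟨α, hα, n, rfl, h⟩ := h
    refine ⟨max N (1 - n).toNat, fun M hM => (hN M (le_of_max_le_left hM)).tail
      ⟨α, pos_mem hα, n, rfl, ?_, h⟩⟩
    have h1 : (1 : ℝ) - n ≤ M := by
      have h2 := Int.self_le_toNat (1 - n)
      have h3 : (1 - n).toNat ≤ M := le_of_max_le_right hM
      have h4 : 1 - n ≤ (M : ℤ) := by omega
      exact_mod_cast h4
    have h2 := (base_mem α hα).2
    have h3 := le_mul_of_one_le_right (Nat.cast_nonneg (α := ℝ) M) (one_le_coroot_eta hα)
    rw [trans_apply, map_add, map_neg, map_smul, smul_eq_mul]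
    linarith

lemma mem_Adm_of_up {x : V ≃ᵃ[ℝ] V} (hx : x ∈ S.extAff)
    (h : ∀ w ∈ S.Weyl, S.Up (S.ofW w * x) (S.trans S.eta * S.ofW w)) : x ∈ S.Adm S.eta := by
  obtain ⟨v, hv, hdom⟩ := exists_dom hx
  obtain ⟨N, hN⟩ := (h v hv).exists_BLE
  have hle := hN (N + 1) N.le_succ
  set M := N + 1 with hM
  have hMX : -((M : ℝ) • S.eta) ∈ S.X := by
    rw [Nat.cast_smul_eq_nsmul]
    exact S.X.neg_mem (S.X.nsmul_mem S.eta_mem_X M)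
  have hv' := S.Weyl.inv_mem hv
  refine ⟨v⁻¹, hv', bruhatLE_of_BLE hx ?_⟩
  have hle' := hle.translate (ofW_mem hv')
  have e1 : S.ofW v⁻¹ * (S.ofW v * x) = x := by
    rw [← mul_assoc, ← ofW_mul, inv_mul_cancel, ofW_one, one_mul]
  have e2 : S.ofW v⁻¹ * (S.trans S.eta * S.ofW v) = S.trans (v⁻¹ S.eta) := by
    rw [← mul_assoc, ofW_mul_trans, mul_assoc, ← ofW_mul, inv_mul_cancel, ofW_one, mul_one]
  rw [e1, e2] at hle'
  refine hle'.move base_regular ((apply_base_regular (trans_mem hMX)).apply (ofW_mem hv')) ?_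
  rintro ⟨γ, n⟩ ⟨hγ, h1, h2⟩
  simp only at hγ h1 h2 ⊢
  obtain ⟨hα, hαv⟩ := weyl_root hv γ hγ
  have hn : n ≤ 0 := by
    have : (n : ℝ) < 1 := h2.trans (coroot_base_lt_one hγ)
    have : n < 1 := by exact_mod_cast this
    omega
  have hn' : (n : ℝ) ≤ 0 := by exact_mod_cast hn
  rcases S.pos_or_neg _ hα with hp | hp
  · have := hdom _ hp
    rw [affine_mul_apply, ofW_apply, hαv] at this
    linarith
  · exfalso
    rw [ofW_apply, ← hαv, linear_apply_inv, trans_apply, map_add, map_neg, map_smul,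
      smul_eq_mul] at h1
    have h3 := (base_mem _ hp).2
    have h4 := le_mul_of_one_le_right (Nat.cast_nonneg (α := ℝ) M) (one_le_coroot_eta hp)
    rw [coroot_neg_apply hα] at h3 h4
    have h5 : (1 : ℝ) ≤ M := by rw [hM]; push_cast; linarith [N.cast_nonneg (α := ℝ)]
    linarith

lemma Dom_of_simple {z : V ≃ᵃ[ℝ] V} (h : ∀ α ∈ S.Δ, 0 < S.coroot α (z S.base)) : S.Dom z :=
  fun _ hα => coroot_pos h hα

lemma trans_mul_ofW_inv (ν : V) (y : V ≃ₗ[ℝ] V) :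
    (S.trans ν * S.ofW y)⁻¹ = S.ofW y⁻¹ * S.trans (-ν) := by
  rw [mul_inv_rev, trans_neg, ofW_inv]

lemma mem_Adm_of_upLE {wt u g : V ≃ᵃ[ℝ] V} (hwt : wt ∈ S.extAff) (hdom : S.Dom wt)
    (huX : u ∈ S.extAff) (hudom : S.Dom u) (hu : S.Up u (S.wh * wt)) {v : V ≃ₗ[ℝ] V}
    (hv : v ∈ S.Weyl) (hg : S.bruhatLE g (S.ofW S.w0 * wt)) :
    u⁻¹ * S.ofW v * g ∈ S.Adm S.eta := by
  have hw0 := w0_mem_Weyl (S := S)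
  have hw0' := S.Weyl.inv_mem hw0
  obtain ⟨hgX, hg⟩ := BLE_of_bruhatLE (extAff_mul (ofW_mem hw0) hwt) hg
  refine mem_Adm_of_up (extAff_mul (extAff_mul (extAff_inv huX) (ofW_mem hv)) hgX) fun w hw => ?_
  obtain ⟨ν, hν, y, hy, rfl⟩ := huX
  set w' := w * y⁻¹ with hw'
  have hw'W : w' ∈ S.Weyl := S.Weyl.mul_mem hw (S.Weyl.inv_mem hy)
  have h1 : S.Up (S.ofW (w' * v) * g) wt :=
    hdom.up_of_bruhatLE hgX hg hwt (S.Weyl.mul_mem hw'W hv)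
  have h2 : S.Up wt (S.trans S.eta * (S.ofW S.w0⁻¹ * (S.trans ν * S.ofW y))) := by
    have h := (hu.reverse hw0' fun α hα => w0_inv_neg hα).trans_mul S.eta_mem_X
    have e : S.trans S.eta * (S.ofW S.w0⁻¹ * (S.wh * wt)) = wt := by
      rw [wh, ofW_inv, trans_neg]
      group
    rwa [e] at h
  have h3 : S.Up (S.trans S.eta * (S.ofW S.w0⁻¹ * (S.trans ν * S.ofW y)))
      (S.trans S.eta * (S.ofW w' * (S.trans ν * S.ofW y))) := by
    have h := ((hudom.up (S.Weyl.mul_mem hw0 hw'W)).reverse hw0'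
      fun α hα => w0_inv_neg hα).trans_mul S.eta_mem_X
    rwa [← mul_assoc (S.ofW S.w0⁻¹) (S.ofW (S.w0 * w')), ← ofW_mul, inv_mul_cancel_left] at h
  have h4 := Up.trans_mul (S.X.neg_mem (weyl_X hw'W _ hν)) ((h1.trans h2).trans h3)
  convert h4 using 1
  · rw [trans_mul_ofW_inv, ofW_mul, hw', ← mul_assoc, ← mul_assoc, ← mul_assoc, ← ofW_mul, ← hw',
      ofW_mul_trans, map_neg]
    simp only [mul_assoc]
  · ext z
    simp only [affine_mul_apply, trans_apply, ofW_apply, hw', linear_mul_apply, map_add,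
      linear_inv_apply]
    abel

lemma upLE_of_mem_Adm {wt u : V ≃ᵃ[ℝ] V} (huX : u ∈ S.extAff)
    (h : u⁻¹ * (S.ofW S.w0 * wt) ∈ S.Adm S.eta) : S.upLE u (S.wh * wt) := by
  have hw0 := w0_mem_Weyl (S := S)
  have hw0' := S.Weyl.inv_mem hw0
  refine upLE_of_Up huX ?_
  obtain ⟨ν, hν, y, hy, rfl⟩ := huX
  have h1 := (up_of_mem_Adm h (S.Weyl.mul_mem hw0' hy)).trans_mul
    (S.X.sub_mem (weyl_X hw0' _ hν) S.eta_mem_X)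
  have h2 := h1.reverse hw0 S.w0_neg
  convert h2 using 1
  · ext z
    simp only [affine_mul_apply, trans_apply, ofW_apply, linear_mul_apply, map_add, map_sub,
      linear_apply_inv]
    abel
  · ext z
    simp only [wh, trans_mul_ofW_inv, affine_mul_apply, trans_apply, ofW_apply, linear_mul_apply,
      map_add, map_sub, map_neg, linear_apply_inv, linear_inv_apply]
    abel

end Ctx

open Ctx

/-- part of Proposition 2.3.8/`combinatorial membership of DL`: for
`w̃ ∈ W̃₁` and `ω − η ∈ C₀`, the existence of `ũ ∈ W̃⁺` with `ũ ↑ w̃_h w̃` and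
`t_ω ∈ t_μ s ũ⁻¹ W` is equivalent to `t_ω W̃_{≤ w₀w̃} ⊆ t_μ s Adm(η)`. -/
theorem statement17 {V : Type} [AddCommGroup V] [Module ℝ V] [FiniteDimensional ℝ V]
    (S : Ctx V) (p : ℕ) (hp : p.Prime) (hηp : ∀ α ∈ S.R, S.coroot α S.eta < (p : ℝ))
    (wt : V ≃ᵃ[ℝ] V) (hwt : wt ∈ S.Wone)
    (ω : V) (hω : ω ∈ S.X) (hωC : ω - S.eta ∈ S.C0 p)
    (μ : V) (hμ : μ ∈ S.X)
    (s : V ≃ₗ[ℝ] V) (hs : s ∈ S.Weyl) :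
    (∃ u ∈ S.Wplus, S.upLE u (S.wh * wt) ∧
        ∃ v ∈ S.Weyl, S.trans ω = S.trans μ * S.ofW s * u⁻¹ * S.ofW v)
      ↔ ∀ g : V ≃ᵃ[ℝ] V, S.bruhatLE g (S.ofW S.w0 * wt) →
          ∃ h ∈ S.Adm S.eta, S.trans ω * g = S.trans μ * S.ofW s * h := by
  have hdom : S.Dom wt := Dom_of_simple fun α hα => (hwt.2 _ base_mem α hα).1
  have hτ : S.trans μ * S.ofW s ∈ S.extAff := extAff_mul (trans_mem hμ) (ofW_mem hs)
  constructor
  · rintro ⟨u, hu, hup, v, hv, he⟩ g hg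
    refine ⟨u⁻¹ * S.ofW v * g, mem_Adm_of_upLE hwt.1 hdom hu.1
      (Dom_of_simple fun α hα => hu.2 _ base_mem α hα) (Up_of_upLE hup) hv hg, ?_⟩
    rw [he]
    simp only [mul_assoc]
  · intro h
    set x := (S.trans μ * S.ofW s)⁻¹ * S.trans ω with hx
    have hxX : x⁻¹ ∈ S.extAff := extAff_inv (extAff_mul (extAff_inv hτ) (trans_mem hω))
    obtain ⟨v, hv, hvdom⟩ := exists_dom hxX
    have huX := extAff_mul (ofW_mem hv) hxX
    have hvw := S.Weyl.mul_mem (S.Weyl.inv_mem hv) w0_mem_Weyl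
    obtain ⟨k, hk, he⟩ := h (S.ofW (v⁻¹ * S.w0) * wt)
      (bruhatLE_of_BLE (extAff_mul (ofW_mem hvw) hwt.1) (hdom.bruhat hvw))
    refine ⟨S.ofW v * x⁻¹, ⟨huX, fun y hy α hα => ?_⟩, upLE_of_mem_Adm huX ?_, v, hv, ?_⟩
    · have := lt_apply_of_mem_A0 huX base_mem hy (simple_mem hα) (m := 0)
        (by rw [Int.cast_zero]; exact hvdom α (simple_pos hα))
      rwa [Int.cast_zero] at this
    · convert hk using 1
      rw [← inv_mul_eq_iff_eq_mul, ← mul_assoc, ← hx] at he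
      rw [← he, mul_inv_rev, inv_inv, ofW_mul, ofW_inv]
      simp only [mul_assoc]
    · rw [hx]
      group

end SerrePaper
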